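/- Every separable infinite dimensional elastic Banach space X is universal for separable Banach spaces: every separable Banach space Y embeds isomorphically into X. -/

import Mathlib

/-- An isomorphic embedding of Banach spaces: a bounded linear map which is
bounded below (hence an isomorphism onto its range). -/
def IsIsomorphicEmbedding {Y X : Type*} [NormedAddCommGroup Y] [NormedSpace ℝ Y]
    [NormedAddCommGroup X] [NormedSpace ℝ X] (T : Y →L[ℝ] X) : Prop :=
  ∃ c : ℝ, 0 < c ∧ ∀ y : Y, c * ‖y‖ ≤ ‖T y‖

/-- `Y` embeds isomorphically into `X`. -/
def EmbedsInto (Y X : Type*) [NormedAddCommGroup Y] [NormedSpace ℝ Y]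
    [NormedAddCommGroup X] [NormedSpace ℝ X] : Prop :=
  ∃ T : Y →L[ℝ] X, IsIsomorphicEmbedding T

/-- `X` is `K`-elastic: whenever a Banach space `Y` embeds isomorphically into `X`,
there is an embedding `T : Y → X` with `‖y‖ ≤ ‖T y‖ ≤ K * ‖y‖` for all `y`. -/
def IsKElastic (X : Type*) [NormedAddCommGroup X] [NormedSpace ℝ X] (K : ℝ) : Prop :=
  ∀ (Y : Type) [NormedAddCommGroup Y] [NormedSpace ℝ Y] [CompleteSpace Y],
    EmbedsInto Y X → ∃ T : Y →L[ℝ] X, ∀ y : Y, ‖y‖ ≤ ‖T y‖ ∧ ‖T y‖ ≤ K * ‖y‖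

namespace ElU

open Filter Topology

/-- Finite linear combination of a family. -/
noncomputable def lc {I X : Type} [AddCommGroup X] [Module ℝ X] (x : I → X) (a : I →₀ ℝ) : X :=
  Finsupp.linearCombination ℝ x a

section
variable {I J X : Type} [NormedAddCommGroup X] [NormedSpace ℝ X]

def Lower (ψ : J → I → ℝ) (x : I → X) (c : ℝ) : Prop :=
  ∀ a j, |lc (ψ j) a| ≤ c * ‖lc x a‖

def Upper (ψ : J → I → ℝ) (x : I → X) (C : ℝ) : Prop :=
  ∀ a R, 0 ≤ R → (∀ j, |lc (ψ j) a| ≤ R) → ‖lc x a‖ ≤ C * R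

def Good (X : Type) [NormedAddCommGroup X] [NormedSpace ℝ X] (ψ : J → I → ℝ) (C : ℝ) : Prop :=
  ∃ x : I → X, Lower ψ x 1 ∧ Upper ψ x C

end

section
variable {I J X Z : Type} [AddCommGroup X] [Module ℝ X] [AddCommGroup Z] [Module ℝ Z]

lemma lc_add (x : I → X) (a b : I →₀ ℝ) : lc x (a + b) = lc x a + lc x b := by
  simp [lc]

lemma lc_sub (x : I → X) (a b : I →₀ ℝ) : lc x (a - b) = lc x a - lc x b := by
  simp [lc]

lemma lc_smul (x : I → X) (r : ℝ) (a : I →₀ ℝ) : lc x (r • a) = r • lc x a := by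
  simp [lc]

lemma lc_zero (x : I → X) : lc x 0 = 0 := by simp [lc]

lemma lc_single (x : I → X) (i : I) (r : ℝ) : lc x (Finsupp.single i r) = r • x i := by
  simp [lc]

lemma lc_eq_sum (x : I → X) (a : I →₀ ℝ) : lc x a = ∑ i ∈ a.support, a i • x i := by
  simp [lc, Finsupp.linearCombination_apply, Finsupp.sum]

lemma lc_eq_sum_of_subset (x : I → X) (a : I →₀ ℝ) (s : Finset I) (h : a.support ⊆ s) :
    lc x a = ∑ i ∈ s, a i • x i := by
  rw [lc_eq_sum]
  apply Finset.sum_subset h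
  intro i _ hi
  simp [Finsupp.notMem_support_iff.1 hi]

lemma lc_map (f : X →ₗ[ℝ] Z) (x : I → X) (a : I →₀ ℝ) : f (lc x a) = lc (fun i => f (x i)) a := by
  simp [lc_eq_sum]

lemma lc_congr {x y : I → X} {a : I →₀ ℝ} (h : ∀ i, a i ≠ 0 → x i = y i) : lc x a = lc y a := by
  rw [lc_eq_sum, lc_eq_sum]
  apply Finset.sum_congr rfl
  intro i hi
  rw [h i (by simpa using hi)]

lemma lc_fun_sub (x y : I → X) (a : I →₀ ℝ) : lc (fun i => x i - y i) a = lc x a - lc y a := by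
  simp [lc_eq_sum, smul_sub]

lemma lc_mapDomain (g : I → J) (x : J → X) (a : I →₀ ℝ) :
    lc x (a.mapDomain g) = lc (fun i => x (g i)) a := by
  simp only [lc, Finsupp.linearCombination_mapDomain]
  rfl

lemma lc_const_zero (a : I →₀ ℝ) : lc (fun _ => (0 : X)) a = 0 := by
  simp [lc_eq_sum]

end

lemma lc_norm_le {I X : Type} [NormedAddCommGroup X] [NormedSpace ℝ X] (x : I → X) (a : I →₀ ℝ) :
    ‖lc x a‖ ≤ ∑ i ∈ a.support, |a i| * ‖x i‖ := by
  rw [lc_eq_sum]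
  refine (norm_sum_le _ _).trans (Finset.sum_le_sum fun i _ => ?_)
  rw [norm_smul, Real.norm_eq_abs]

/-- Extension of a two-sided estimate from a span to its closure. -/
lemma span_ext {I E X : Type} [NormedAddCommGroup E] [NormedSpace ℝ E]
    [NormedAddCommGroup X] [NormedSpace ℝ X] [CompleteSpace X]
    (b : I → E) (x : I → X) (c C : ℝ)
    (h1 : ∀ a, ‖lc b a‖ ≤ c * ‖lc x a‖) (h2 : ∀ a, ‖lc x a‖ ≤ C * ‖lc b a‖) :
    ∃ T : (Submodule.span ℝ (Set.range b)).topologicalClosure →L[ℝ] X,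
      IsIsomorphicEmbedding T ∧ ∀ (i : I) (h : b i ∈ (Submodule.span ℝ (Set.range b)).topologicalClosure),
        T ⟨b i, h⟩ = x i := by
  set S := Submodule.span ℝ (Set.range b) with hS
  have hmem : ∀ a, lc b a ∈ S.topologicalClosure := fun a => by
    apply Submodule.le_topologicalClosure
    rw [hS, ← Finsupp.range_linearCombination]
    exact ⟨a, rfl⟩
  let e : (I →₀ ℝ) →ₗ[ℝ] S.topologicalClosure :=
    LinearMap.codRestrict _ (Finsupp.linearCombination ℝ b) hmem
  let f : (I →₀ ℝ) →ₗ[ℝ] X := Finsupp.linearCombination ℝ x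
  have hd : DenseRange e := by
    rw [DenseRange, Subtype.dense_iff]
    intro y hy
    have : (S : Set E) ⊆ (Subtype.val '' Set.range e) := by
      intro z hz
      have hz' : z ∈ LinearMap.range (Finsupp.linearCombination ℝ b) := by
        rw [Finsupp.range_linearCombination]; exact hz
      obtain ⟨a, rfl⟩ := hz'
      exact ⟨_, ⟨a, rfl⟩, rfl⟩
    exact closure_mono this hy
  have hn : ∃ C, ∀ a, ‖f a‖ ≤ C * ‖e a‖ := ⟨C, fun a => h2 a⟩
  have hT : ∀ a, f.extendOfNorm e (e a) = f a := LinearMap.extendOfNorm_eq hd hn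
  have hc : ∀ y, ‖y‖ ≤ (|c| + 1) * ‖f.extendOfNorm e y‖ := by
    intro y
    refine hd.induction_on (p := fun y => ‖y‖ ≤ (|c| + 1) * ‖f.extendOfNorm e y‖) y ?_ ?_
    · exact isClosed_le (by fun_prop) (by fun_prop)
    · intro a
      rw [hT]
      refine (h1 a).trans ?_
      have := le_abs_self c
      have h3 : 0 ≤ ‖lc x a‖ := norm_nonneg _
      change c * ‖lc x a‖ ≤ (|c| + 1) * ‖lc x a‖
      nlinarith
  refine ⟨f.extendOfNorm e, ⟨(|c| + 1)⁻¹, by positivity, fun y => ?_⟩, fun i h => ?_⟩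
  · rw [inv_mul_le_iff₀ (by positivity)]
    exact hc y
  · have : (⟨b i, h⟩ : S.topologicalClosure) = e (Finsupp.single i 1) := by
      apply Subtype.ext
      change b i = Finsupp.linearCombination ℝ b (Finsupp.single i 1)
      simp
    rw [this, hT]
    simp [f]

/-- The rows of a sup family as elements of `ℓ^∞`. -/
lemma exists_lp {I J : Type} (ψ : J → I → ℝ) (hb : ∀ i, ∃ B, ∀ j, |ψ j i| ≤ B) :
    ∃ b : I → lp (fun _ : J => ℝ) ⊤, (∀ i j, b i j = ψ j i) ∧ (∀ a j, (lc b a) j = lc (ψ j) a) ∧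
     (∀ a R, 0 ≤ R → (∀ j, |lc (ψ j) a| ≤ R) → ‖lc b a‖ ≤ R) ∧
     (∀ a j, |lc (ψ j) a| ≤ ‖lc b a‖) := by
  let b : I → lp (fun _ : J => ℝ) ⊤ := fun i => ⟨fun j => ψ j i, by
    apply memℓp_infty
    obtain ⟨B, hB⟩ := hb i
    refine ⟨B, ?_⟩
    rintro _ ⟨j, rfl⟩
    simpa using hB j⟩
  have hbj : ∀ i j, b i j = ψ j i := fun i j => rfl
  have hlc : ∀ a j, (lc b a) j = lc (ψ j) a := by
    intro a j
    let ev : lp (fun _ : J => ℝ) ⊤ →ₗ[ℝ] ℝ :=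
      { toFun := fun f => f j, map_add' := fun _ _ => rfl, map_smul' := fun _ _ => rfl }
    exact lc_map ev b a
  refine ⟨b, hbj, hlc, fun a R hR h => ?_, fun a j => ?_⟩
  · apply lp.norm_le_of_forall_le hR
    intro j
    rw [hlc]
    exact h j
  · rw [← hlc]
    exact lp.norm_apply_le_norm ENNReal.top_ne_zero (lc b a) j

/-- Lemma A. -/
lemma elastic_good {I J X : Type} [NormedAddCommGroup X] [NormedSpace ℝ X] [CompleteSpace X] {K : ℝ}
    (hK : IsKElastic X K) (hK1 : 1 ≤ K) (ψ : J → I → ℝ) (hb : ∀ i, ∃ B, ∀ j, |ψ j i| ≤ B)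
    (x : I → X) (c C : ℝ) (hl : Lower ψ x c) (hu : Upper ψ x C) : Good X ψ K := by
  obtain ⟨b, hbj, hlc, hb1, hb2⟩ := exists_lp ψ hb
  have h1 : ∀ a, ‖lc b a‖ ≤ |c| * ‖lc x a‖ := fun a => by
    refine hb1 a _ (by positivity) fun j => (hl a j).trans ?_
    gcongr
    exact le_abs_self c
  have h2 : ∀ a, ‖lc x a‖ ≤ C * ‖lc b a‖ := fun a => hu a _ (norm_nonneg _) (hb2 a)
  obtain ⟨T, hT, -⟩ := span_ext b x _ C h1 h2
  have : CompleteSpace (Submodule.span ℝ (Set.range b)).topologicalClosure :=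
    (Submodule.isClosed_topologicalClosure _).completeSpace_coe
  obtain ⟨T', hT'⟩ := hK _ ⟨T, hT⟩
  have hmem : ∀ i, b i ∈ (Submodule.span ℝ (Set.range b)).topologicalClosure := fun i =>
    Submodule.le_topologicalClosure _ (Submodule.subset_span ⟨i, rfl⟩)
  let e : I → (Submodule.span ℝ (Set.range b)).topologicalClosure := fun i => ⟨b i, hmem i⟩
  have he : ∀ a, ‖lc e a‖ = ‖lc b a‖ := by
    intro a
    have := lc_map (Submodule.subtype (Submodule.span ℝ (Set.range b)).topologicalClosure) e a
    exact congrArg norm this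
  have hT3 : ∀ a, lc (fun i => T' (e i)) a = T' (lc e a) := fun a =>
    (lc_map T'.toLinearMap e a).symm
  refine ⟨fun i => T' (e i), ?_, ?_⟩
  · intro a j
    rw [hT3, one_mul]
    exact (hb2 a j).trans ((he a).symm.le.trans (hT' _).1)
  · intro a R hR h
    rw [hT3]
    have hle := hb1 a R hR h
    refine (hT' _).2.trans ?_
    rw [he]
    gcongr

/-- Lemma A2 (Hahn-Banach functional). -/
lemma hb_functional {I X : Type} [NormedAddCommGroup X] [NormedSpace ℝ X]
    (ψ : I → ℝ) (y : I → X) (c : ℝ) (hc : 0 ≤ c) (h : ∀ a, |lc ψ a| ≤ c * ‖lc y a‖) :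
    ∃ f : StrongDual ℝ X, ‖f‖ ≤ c ∧ ∀ i, f (y i) = ψ i := by
  let e : (I →₀ ℝ) →ₗ[ℝ] LinearMap.range (Finsupp.linearCombination ℝ y) :=
    (Finsupp.linearCombination ℝ y).rangeRestrict
  have hn : ∃ C, ∀ a, ‖(Finsupp.linearCombination ℝ ψ) a‖ ≤ C * ‖e a‖ := ⟨c, h⟩
  have hd : DenseRange e := (LinearMap.surjective_rangeRestrict _).denseRange
  let g := (Finsupp.linearCombination ℝ ψ).extendOfNorm e
  have hg : ∀ a, g (e a) = Finsupp.linearCombination ℝ ψ a := LinearMap.extendOfNorm_eq hd hn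
  have hgn : ‖g‖ ≤ c := by
    apply ContinuousLinearMap.opNorm_le_bound _ hc
    intro z
    obtain ⟨a, rfl⟩ := LinearMap.surjective_rangeRestrict _ z
    rw [hg]
    exact h a
  obtain ⟨f, hf, hfn⟩ := exists_extension_norm_eq _ g
  refine ⟨f, hfn.le.trans hgn, fun i => ?_⟩
  have h1 := hf (e (Finsupp.single i 1))
  rw [hg] at h1
  have h2 : ((e (Finsupp.single i 1)) : X) = y i := by
    change Finsupp.linearCombination ℝ y (Finsupp.single i 1) = y i
    simp
  rw [h2] at h1
  simpa using h1

end ElU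

namespace ElU

open Filter Topology

/-- The suffix of length `m`. -/
def suf (τ : List ℕ) (m : ℕ) : List ℕ := τ.drop (τ.length - m)

lemma suf_eq_of_suffix {σ τ : List ℕ} (h : σ <:+ τ) : suf τ σ.length = σ :=
  (List.suffix_iff_eq_drop.1 h).symm

lemma suf_length {τ : List ℕ} {m : ℕ} (h : m ≤ τ.length) : (suf τ m).length = m := by
  simp [suf]; omega

lemma suf_suffix (τ : List ℕ) (m : ℕ) : suf τ m <:+ τ := List.drop_suffix _ _

lemma suf_self (τ : List ℕ) : suf τ τ.length = τ := by simp [suf]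

lemma getD_reverse_of_suffix {σ τ : List ℕ} (h : σ <:+ τ) {m : ℕ} (hm : m < σ.length) :
    τ.reverse.getD m 0 = σ.reverse.getD m 0 := by
  obtain ⟨t, rfl⟩ := h
  rw [List.reverse_append, List.getD_append _ _ _ _ (by simpa using hm)]

def ExtRel (T : List ℕ → Prop) : List ℕ → List ℕ → Prop := fun τ' τ => T τ' ∧ ∃ n, τ' = n :: τ

lemma chain_suffix {g : ℕ → List ℕ} (hg : ∀ i, ∃ n, g (i + 1) = n :: g i) {i j : ℕ} (hij : i ≤ j) :
    g i <:+ g j := by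
  induction hij with
  | refl => exact List.suffix_refl _
  | step _ ih =>
    obtain ⟨n, hn⟩ := hg _
    rw [hn]
    exact ih.trans (List.suffix_cons _ _)

/-- Lemma B (the principle). -/
lemma principle {X J : Type} [NormedAddCommGroup X] [NormedSpace ℝ X]
    [TopologicalSpace.SeparableSpace X] (K : ℝ) (φ : J → ℕ → ℝ) (live : ℕ → Prop)
    (hlive : ∀ m, live m → ∃ c : ℝ, ∀ (a : ℕ →₀ ℝ) (R : ℝ), 0 ≤ R → (∀ j, |lc (φ j) a| ≤ R) →
      |a m| ≤ c * R)
    (H : ∀ T : List ℕ → Prop, T [] → (∀ n τ, T (n :: τ) → T τ) → WellFounded (ExtRel T) →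
      ∃ x : List ℕ → X, (∀ τ, ¬ live τ.length → x τ = 0) ∧
        ∀ τ, T τ → ∀ a : ℕ →₀ ℝ, (∀ m, τ.length < m → a m = 0) →
          (∀ j, |lc (φ j) a| ≤ ‖lc (fun m => x (suf τ m)) a‖) ∧
          ∀ R, 0 ≤ R → (∀ j, |lc (φ j) a| ≤ R) → ‖lc (fun m => x (suf τ m)) a‖ ≤ K * R) :
    ∃ x : ℕ → X, Lower φ x 2 ∧ Upper φ x (K + 1) := by
  classical
  obtain ⟨D, hD0, hD⟩ : ∃ D : ℕ → X, D 0 = 0 ∧ DenseRange D := by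
    refine ⟨fun n => Nat.casesOn n 0 (TopologicalSpace.denseSeq X), rfl, ?_⟩
    refine (TopologicalSpace.denseRange_denseSeq X).mono ?_
    rintro _ ⟨n, rfl⟩
    exact ⟨n + 1, rfl⟩
  obtain ⟨c, hc0, hc⟩ : ∃ c : ℕ → ℝ, (∀ m, 0 < c m) ∧ ∀ m, live m → ∀ (a : ℕ →₀ ℝ) (R : ℝ),
      0 ≤ R → (∀ j, |lc (φ j) a| ≤ R) → |a m| ≤ c m * R := by
    have : ∀ m, ∃ c : ℝ, 0 < c ∧ (live m → ∀ (a : ℕ →₀ ℝ) (R : ℝ),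
      0 ≤ R → (∀ j, |lc (φ j) a| ≤ R) → |a m| ≤ c * R) := by
      intro m
      by_cases h : live m
      · obtain ⟨c, hc⟩ := hlive m h
        refine ⟨|c| + 1, by positivity, fun _ a R hR hj => (hc a R hR hj).trans ?_⟩
        gcongr
        linarith [le_abs_self c]
      · exact ⟨1, one_pos, fun h' => absurd h' h⟩
    choose c hc using this
    exact ⟨c, fun m => (hc m).1, fun m => (hc m).2⟩
  let ε : ℕ → ℝ := fun m => (1 / 2) ^ (m + 2) / c m
  have hε : ∀ m, 0 < ε m := fun m => div_pos (by positivity) (hc0 m)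
  let vD : List ℕ → ℕ → X := fun σ m => D (σ.reverse.getD m 0)
  let T : List ℕ → Prop := fun σ => ∀ a : ℕ →₀ ℝ, (∀ m, σ.length ≤ m → a m = 0) →
    (∀ j, |lc (φ j) a| ≤ 2 * ‖lc (vD σ) a‖) ∧
      ∀ R, 0 ≤ R → (∀ j, |lc (φ j) a| ≤ R) → ‖lc (vD σ) a‖ ≤ (K + 1) * R
  have hT0 : T [] := by
    intro a ha
    have : a = 0 := by
      ext m
      exact ha m (Nat.zero_le _)
    subst this
    refine ⟨fun j => by simp [lc_zero], fun R hR h => ?_⟩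
    obtain ⟨x, hx0, hx⟩ := H (fun τ => τ = []) rfl (by simp) (by
      constructor
      intro τ
      constructor
      rintro τ' ⟨h1, n, h2⟩
      simp [h1] at h2)
    have h1 := (hx [] rfl 0 (by simp)).2 R hR h
    rw [lc_zero] at *
    simp only [norm_zero] at *
    linarith
  have hTs : ∀ n τ, T (n :: τ) → T τ := by
    intro n τ h a ha
    have h1 := h a (fun m hm => ha m (by simp at hm; omega))
    have h2 : lc (vD τ) a = lc (vD (n :: τ)) a := by
      apply lc_congr
      intro m hm
      have hm' : m < τ.length := by
        by_contra h'
        exact hm (ha m (by omega))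
      exact congrArg D (getD_reverse_of_suffix (List.suffix_cons n τ) hm').symm
    rw [h2]
    exact h1
  by_cases hW : WellFounded (ExtRel T)
  · exfalso
    obtain ⟨x, hx0, hx⟩ := H T hT0 hTs hW
    have hn : ∀ σ : List ℕ, ∃ n, ‖D n - x σ‖ ≤ ε σ.length ∧ (¬ live σ.length → D n = 0) := by
      intro σ
      by_cases hl : live σ.length
      · obtain ⟨n, hn⟩ := hD.exists_dist_lt (x σ) (hε σ.length)
        refine ⟨n, ?_, fun h => absurd hl h⟩
        rw [← dist_eq_norm, dist_comm]
        exact hn.le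
      · refine ⟨0, ?_, fun _ => hD0⟩
        rw [hD0, hx0 σ hl]
        simpa using (hε _).le
    choose n hn1 hn2 using hn
    obtain ⟨s, hs0, hs⟩ : ∃ s : ℕ → List ℕ, s 0 = [] ∧ ∀ k, s (k + 1) = n (s k) :: s k :=
      ⟨fun k => Nat.rec [] (fun _ σ => n σ :: σ) k, rfl, fun k => rfl⟩
    have hsl : ∀ k, (s k).length = k := by
      intro k
      induction k with
      | zero => rw [hs0]; rfl
      | succ k ih => rw [hs, List.length_cons, ih]
    have hsuf : ∀ {i j}, i ≤ j → s i <:+ s j := fun h => chain_suffix (fun i => ⟨_, hs i⟩) h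
    have hTk : ∀ k, T (s k) := by
      intro k
      induction k with
      | zero => rw [hs0]; exact hT0
      | succ k ih =>
        intro a ha
        have ha' : ∀ m, k < m → a m = 0 := fun m hm => ha m (by rw [hsl]; omega)
        have hxa := hx (s k) ih a (fun m hm => ha' m (by rwa [hsl] at hm))
        have hdiff : ∀ R, 0 ≤ R → (∀ j, |lc (φ j) a| ≤ R) →
            ‖lc (vD (s (k + 1))) a - lc (fun m => x (suf (s k) m)) a‖ ≤ R / 2 := by
          intro R hR hj
          rw [← lc_fun_sub]
          have hsub : a.support ⊆ Finset.range (k + 1) := by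
            intro m hm
            rw [Finset.mem_range]
            by_contra h'
            exact (Finsupp.mem_support_iff.1 hm) (ha' m (by omega))
          rw [lc_eq_sum_of_subset _ _ _ hsub]
          have hterm : ∀ m ∈ Finset.range (k + 1), ‖a m • (vD (s (k + 1)) m - x (suf (s k) m))‖ ≤
              (1 / 2) ^ (m + 2) * R := by
            intro m hm
            rw [Finset.mem_range] at hm
            have e1 : suf (s k) m = s m := by
              have := suf_eq_of_suffix (hsuf (show m ≤ k by omega))
              rwa [hsl] at this
            have e2 : vD (s (k + 1)) m = D (n (s m)) := by
              have := getD_reverse_of_suffix (hsuf (show m + 1 ≤ k + 1 by omega))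
                (m := m) (by rw [hsl]; omega)
              change D _ = D _
              rw [this, hs, List.reverse_cons, List.getD_append_right _ _ _ _ (by simp [hsl])]
              simp [hsl]
            rw [e1, e2, norm_smul, Real.norm_eq_abs]
            by_cases hl : live m
            · have h1 := hc m hl a R hR hj
              have h2 := hn1 (s m)
              rw [hsl] at h2
              calc |a m| * ‖D (n (s m)) - x (s m)‖ ≤ (c m * R) * ε m :=
                    mul_le_mul h1 h2 (norm_nonneg _) (mul_nonneg (hc0 m).le hR)
                _ = (1 / 2) ^ (m + 2) * R := by
                  have := (hc0 m).ne'
                  simp only [ε]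
                  field_simp
            · have hl' : ¬ live (s m).length := by rwa [hsl]
              rw [hn2 _ hl', hx0 _ hl']
              simp only [sub_zero, norm_zero, mul_zero]
              positivity
          refine (norm_sum_le_of_le _ hterm).trans ?_
          rw [← Finset.sum_mul]
          have hg : ∀ N, ∑ m ∈ Finset.range N, ((1 : ℝ) / 2) ^ (m + 2) ≤ 1 / 2 := by
            intro N
            have : ∑ m ∈ Finset.range N, ((1 : ℝ) / 2) ^ (m + 2) = 1 / 2 - (1 / 2) ^ (N + 1) := by
              induction N with
              | zero => simp
              | succ N ihN => rw [Finset.sum_range_succ, ihN]; ring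
            rw [this]
            have : (0 : ℝ) < (1 / 2) ^ (N + 1) := by positivity
            linarith
          have := hg (k + 1)
          nlinarith
        constructor
        · intro j
          have h1 := hdiff _ (norm_nonneg _) hxa.1
          have h2 := hxa.1 j
          have h3 := norm_sub_norm_le (lc (fun m => x (suf (s k) m)) a) (lc (vD (s (k + 1))) a)
          rw [norm_sub_rev] at h3
          linarith
        · intro R hR hj
          have h1 := hdiff R hR hj
          have h2 := hxa.2 R hR hj
          have h3 := norm_sub_norm_le (lc (vD (s (k + 1))) a) (lc (fun m => x (suf (s k) m)) a)
          linarith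
    rw [wellFounded_iff_isEmpty_descending_chain] at hW
    exact hW.elim ⟨s, fun k => ⟨hTk (k + 1), _, hs k⟩⟩
  · rw [wellFounded_iff_isEmpty_descending_chain, not_isEmpty_iff] at hW
    obtain ⟨g, hg⟩ := hW
    have hgs : ∀ i, ∃ n, g (i + 1) = n :: g i := fun i => (hg i).2
    have hgl : ∀ i, i ≤ (g i).length := by
      intro i
      induction i with
      | zero => omega
      | succ i ih =>
        obtain ⟨n, hn⟩ := hgs i
        rw [hn, List.length_cons]
        omega
    let x : ℕ → X := fun m => D ((g (m + 1)).reverse.getD m 0)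
    have key : ∀ a : ℕ →₀ ℝ, ∃ i, T (g (i + 1)) ∧ lc (vD (g (i + 1))) a = lc x a ∧
        ∀ m, (g (i + 1)).length ≤ m → a m = 0 := by
      intro a
      obtain ⟨N, hN⟩ := a.support.bddAbove
      have hN' : ∀ m, N < m → a m = 0 := by
        intro m hm
        by_contra h'
        have := hN (Finset.mem_coe.2 (Finsupp.mem_support_iff.2 h'))
        omega
      refine ⟨N, (hg N).1, ?_, fun m hm => hN' m ?_⟩
      · apply lc_congr
        intro m hm
        have hm' : m ≤ N := by
          by_contra h'
          exact hm (hN' m (by omega))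
        exact congrArg D (getD_reverse_of_suffix (chain_suffix hgs (by omega)) (by
          have := hgl (m + 1)
          omega))
      · have := hgl (N + 1)
        omega
    refine ⟨x, ?_, ?_⟩
    · intro a j
      obtain ⟨i, hi, he, hz⟩ := key a
      rw [← he]
      exact (hi a hz).1 j
    · intro a R hR hj
      obtain ⟨i, hi, he, hz⟩ := key a
      rw [← he]
      exact (hi a hz).2 R hR hj

end ElU

namespace ElU

open Filter Topology

open Classical in
/-- Real-valued truth value. -/
noncomputable def ind (p : Prop) : ℝ := if p then 1 else 0

lemma ind_true {p : Prop} (h : p) : ind p = 1 := if_pos h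
lemma ind_false {p : Prop} (h : ¬ p) : ind p = 0 := if_neg h
lemma ind_congr {p q : Prop} (h : p ↔ q) : ind p = ind q := by rw [propext h]
lemma abs_ind_le (p : Prop) : |ind p| ≤ 1 := by
  by_cases h : p <;> simp [ind, h]

lemma lc_ind_eq {I : Type} (a : I →₀ ℝ) (v : I) : lc (fun i => ind (i = v)) a = a v := by
  classical
  rw [lc_eq_sum, Finset.sum_eq_single v]
  · simp [ind]
  · intro b _ hb
    simp [ind, hb]
  · intro h
    simp [Finsupp.notMem_support_iff.1 h]

lemma exists_seq_of_forall {St : Type*} [Nonempty St] (R : ℕ → (ℕ → St) → St → Prop)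
    (hcongr : ∀ c h h' s, (∀ m, m < c → h m = h' m) → R c h s → R c h' s)
    (hex : ∀ c h, ∃ s, R c h s) : ∃ g : ℕ → St, ∀ c, R c g (g c) := by
  classical
  choose F hF using hex
  obtain ⟨s0⟩ := ‹Nonempty St›
  let g : ℕ → St := fun c => Nat.strongRecOn c
    (fun c ih => F c (fun m => if h : m < c then ih m h else s0))
  have hg : ∀ c, g c = F c (fun m => if m < c then g m else s0) := by
    intro c
    simp only [g]
    rw [Nat.strongRecOn_eq]
    congr 1
  refine ⟨g, fun c => ?_⟩
  have h1 := hF c (fun m => if m < c then g m else s0)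
  rw [← hg] at h1
  exact hcongr c _ _ _ (fun m hm => by simp [hm]) h1

lemma encode_tail_lt (k : ℕ) (p : List ℕ) : Encodable.encode p < Encodable.encode (k :: p) := by
  rw [Encodable.encode_list_cons]
  exact Nat.lt_succ_of_le (Nat.right_le_pair _ _)

lemma encode_suffix_le {w u : List ℕ} (h : w <:+ u) : Encodable.encode w ≤ Encodable.encode u := by
  induction u with
  | nil => rw [List.suffix_nil.1 h]
  | cons k p ih =>
    rcases List.suffix_cons_iff.1 h with h | h
    · rw [h]
    · exact (ih h).trans (encode_tail_lt k p).le

lemma encode_pair_tail_lt (ρ : List ℕ) (k : ℕ) (p : List ℕ) :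
    Encodable.encode (ρ, p) < Encodable.encode (ρ, k :: p) := by
  simp only [Encodable.encode_prod_val]
  exact Nat.pair_lt_pair_right _ (encode_tail_lt k p)

lemma encode_pair_nil_le (ρ : List ℕ) (p : List ℕ) :
    Encodable.encode (ρ, ([] : List ℕ)) ≤ Encodable.encode (ρ, p) := by
  induction p with
  | nil => exact le_rfl
  | cons k p ih => exact ih.trans (encode_pair_tail_lt ρ k p).le

lemma encode_pair_suffix_le (ρ : List ℕ) {w u : List ℕ} (h : w <:+ u) :
    Encodable.encode (ρ, w) ≤ Encodable.encode (ρ, u) := by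
  induction u with
  | nil => rw [List.suffix_nil.1 h]
  | cons k p ih =>
    rcases List.suffix_cons_iff.1 h with h | h
    · rw [h]
    · exact (ih h).trans (encode_pair_tail_lt ρ k p).le

lemma half_pow_lt {m n : ℕ} (h : m < n) : 2 * (1 / 2 : ℝ) ^ n ≤ (1 / 2) ^ m := by
  have : (1 / 2 : ℝ) ^ n ≤ (1 / 2) ^ (m + 1) := pow_le_pow_of_le_one (by norm_num) (by norm_num) h
  rw [pow_succ] at this
  linarith

lemma sum_half_encode {I : Type} [Encodable I] (s : Finset I) :
    ∑ i ∈ s, (1 / 2 : ℝ) ^ (Encodable.encode i) ≤ 2 := by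
  classical
  have h1 : ∑ i ∈ s, (1 / 2 : ℝ) ^ (Encodable.encode i) =
      ∑ m ∈ s.image Encodable.encode, (1 / 2 : ℝ) ^ m := by
    rw [Finset.sum_image]
    intro x _ y _ h
    exact Encodable.encode_injective h
  rw [h1]
  have h2 := summable_geometric_two.sum_le_tsum (s.image (Encodable.encode)) (fun i _ => by positivity)
  rw [tsum_geometric_two] at h2
  exact h2

section
variable {X St : Type} [NormedAddCommGroup X] [NormedSpace ℝ X]

lemma fusion_build (vec : St → X) (fn : St → StrongDual ℝ X) 
    (Opt : St → ℕ → St → Prop)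
    (H : ∀ s k, ∃ o : ℕ → St, (∀ j, Opt s k (o j)) ∧
      (∀ s', Tendsto (fun j => fn s' (vec (o j))) atTop (𝓝 0)) ∧
      ∀ s', Tendsto (fun j => fn (o j) (vec s')) atTop (𝓝 (fn s (vec s'))))
    (s : List ℕ → St) :
    ∃ st : List ℕ × List ℕ → St, (∀ ρ, st (ρ, []) = s ρ) ∧
      (∀ ρ k p, Opt (st (ρ, p)) k (st (ρ, k :: p))) ∧
      ∀ ρ k p m, Encodable.encode m < Encodable.encode (ρ, k :: p) →
        |fn (st m) (vec (st (ρ, k :: p)))| ≤ (1 / 24) * (1 / 2) ^ (Encodable.encode (ρ, k :: p)) ∧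
        |fn (st (ρ, k :: p)) (vec (st m)) - fn (st (ρ, p)) (vec (st m))| ≤
          (1 / 24) * (1 / 2) ^ (Encodable.encode (ρ, k :: p)) := by
  have : Nonempty St := ⟨s []⟩
  let R : ℕ → (ℕ → St) → St → Prop := fun c h t =>
    (∀ ρ : List ℕ, Encodable.encode (ρ, ([] : List ℕ)) = c → t = s ρ) ∧
    (∀ (ρ : List ℕ) (k : ℕ) (p : List ℕ), Encodable.encode (ρ, k :: p) = c →
      Opt (h (Encodable.encode (ρ, p))) k t ∧ ∀ m, m < c →
        |fn (h m) (vec t)| ≤ (1 / 24) * (1 / 2) ^ c ∧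
        |fn t (vec (h m)) - fn (h (Encodable.encode (ρ, p))) (vec (h m))| ≤ (1 / 24) * (1 / 2) ^ c)
  obtain ⟨g, hg⟩ := exists_seq_of_forall R (by
    rintro c h h' t hh ⟨h1, h2⟩
    refine ⟨h1, fun ρ k p hc => ?_⟩
    have h3 := h2 ρ k p hc
    rw [hh _ (hc ▸ encode_pair_tail_lt ρ k p)] at h3
    refine ⟨h3.1, fun m hm => ?_⟩
    rw [← hh m hm]
    exact h3.2 m hm) (by
    intro c h
    obtain ⟨⟨ρ, u⟩, hu⟩ : ∃ v : List ℕ × List ℕ, Encodable.encode v = c :=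
      ⟨Denumerable.ofNat _ c, by simp⟩
    have hinj : ∀ ρ' u', Encodable.encode ((ρ', u') : List ℕ × List ℕ) = c → ρ' = ρ ∧ u' = u := by
      intro ρ' u' h'
      rw [← hu] at h'
      simpa using Encodable.encode_injective h'
    rcases u with _ | ⟨k, p⟩
    · refine ⟨s ρ, fun ρ' h' => ?_, fun ρ' k p h' => ?_⟩
      · rw [(hinj _ _ h').1]
      · simpa using (hinj _ _ h').2
    · obtain ⟨o, ho1, ho2, ho3⟩ := H (h (Encodable.encode (ρ, p))) k
      have hε : (0 : ℝ) < (1 / 24) * (1 / 2) ^ c := by positivity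
      have hev : ∀ᶠ j in atTop, ∀ m ∈ Finset.range c, |fn (h m) (vec (o j))| ≤ (1 / 24) * (1 / 2) ^ c ∧
        |fn (o j) (vec (h m)) - fn (h (Encodable.encode (ρ, p))) (vec (h m))| ≤
          (1 / 24) * (1 / 2) ^ c := by
        rw [Filter.eventually_all_finset]
        intro m _
        have e1 := (ho2 (h m)).eventually (Metric.closedBall_mem_nhds _ hε)
        have e2 := (ho3 (h m)).eventually (Metric.closedBall_mem_nhds _ hε)
        filter_upwards [e1, e2] with j h1 h2
        rw [Real.dist_eq] at h1 h2
        rw [sub_zero] at h1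
        exact ⟨h1, h2⟩
      obtain ⟨j, hj⟩ := hev.exists
      refine ⟨o j, fun ρ' h' => ?_, fun ρ' k' p' h' => ?_⟩
      · simpa using (hinj _ _ h').2
      · obtain ⟨rfl, h2⟩ := hinj _ _ h'
        obtain ⟨rfl, rfl⟩ := List.cons_eq_cons.1 h2
        exact ⟨ho1 j, fun m hm => hj m (Finset.mem_range.2 hm)⟩)
  refine ⟨fun v => g (Encodable.encode v), fun ρ => (hg _).1 ρ rfl, fun ρ k p => ((hg _).2 ρ k p rfl).1,
    fun ρ k p m hm => ((hg _).2 ρ k p rfl).2 _ hm⟩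

/-- Lemma C (fusion). -/
lemma fusion (vec : St → X) (fn : St → StrongDual ℝ X) (D : ℝ) (hD : ∀ s, ‖fn s‖ ≤ D)
    (Opt : St → ℕ → St → Prop)
    (H : ∀ s k, ∃ o : ℕ → St, (∀ j, Opt s k (o j)) ∧
      (∀ s', Tendsto (fun j => fn s' (vec (o j))) atTop (𝓝 0)) ∧
      ∀ s', Tendsto (fun j => fn (o j) (vec s')) atTop (𝓝 (fn s (vec s'))))
    (s : List ℕ → St) :
    ∃ st : List ℕ × List ℕ → St, (∀ ρ, st (ρ, []) = s ρ) ∧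
      (∀ ρ k p, Opt (st (ρ, p)) k (st (ρ, k :: p))) ∧
      ∀ lv : List ℕ × List ℕ → Prop, (∀ ρ, ¬ lv (ρ, [])) →
        (∀ v, lv v → fn (st v) (vec (st v)) = 1) → (∀ v, ¬ lv v → vec (st v) = 0) →
        ∀ (a : List ℕ × List ℕ →₀ ℝ) ρ u,
          |lc (fun v => ind (v.1 = ρ ∧ v.2 <:+ u ∧ lv v)) a| ≤ 4 * D * ‖lc (fun v => vec (st v)) a‖ := by
  obtain ⟨st, h1, h2, h3⟩ := fusion_build vec fn Opt H s
  refine ⟨st, h1, h2, fun lv lv0 lv1 lv2 a => ?_⟩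
  -- pointwise estimate
  have est : ∀ (ρ u : List ℕ) (v : List ℕ × List ℕ), lv v →
      |(fn (st (ρ, u)) - fn (st (ρ, []))) (vec (st v)) - ind (v.1 = ρ ∧ v.2 <:+ u ∧ lv v)| ≤
        (1 / 8) * (1 / 2) ^ (Encodable.encode v) := by
    intro ρ u v hv
    obtain ⟨ρ', w⟩ := v
    rcases w with _ | ⟨k', p'⟩
    · exact absurd hv (lv0 _)
    set v := (ρ', k' :: p') with hvdef
    set ε : ℕ → ℝ := fun c => (1 / 24) * (1 / 2) ^ c with hεdef
    have hεpos : ∀ c, 0 < ε c := fun c => by simp only [hεdef]; positivity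
    have hεlt : ∀ {m n}, m < n → 2 * ε n ≤ ε m := by
      intro m n h
      have := half_pow_lt h
      simp only [hεdef]
      linarith
    have hsmall : ∀ m, Encodable.encode m < Encodable.encode v →
        |fn (st m) (vec (st v))| ≤ ε (Encodable.encode v) := fun m hm => (h3 ρ' k' p' m hm).1
    have hearly : ∀ u, Encodable.encode (ρ, u) < Encodable.encode v →
      |(fn (st (ρ, u)) - fn (st (ρ, []))) (vec (st v)) - ind (v.1 = ρ ∧ v.2 <:+ u ∧ lv v)| ≤
        2 * ε (Encodable.encode v) := by
      intro u hu
      have hns : ¬ (v.1 = ρ ∧ v.2 <:+ u ∧ lv v) := by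
        rintro ⟨hρ, hs, -⟩
        have := encode_pair_suffix_le ρ hs
        rw [← hρ] at hu this
        exact absurd hu (not_lt.2 this)
      rw [ind_false hns, sub_zero, sub_apply]
      have e1 := hsmall _ hu
      have e2 := hsmall _ ((encode_pair_nil_le ρ u).trans_lt hu)
      have := abs_sub (fn (st (ρ, u)) (vec (st v))) (fn (st (ρ, [])) (vec (st v)))
      linarith
    have hlate : ∀ u, Encodable.encode v ≤ Encodable.encode (ρ, u) →
      |(fn (st (ρ, u)) - fn (st (ρ, []))) (vec (st v)) - ind (v.1 = ρ ∧ v.2 <:+ u ∧ lv v)| ≤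
        3 * ε (Encodable.encode v) - ε (Encodable.encode (ρ, u)) := by
      intro u
      induction u with
      | nil =>
        intro hu
        have hns : ¬ (v.1 = ρ ∧ v.2 <:+ [] ∧ lv v) := by
          rintro ⟨hρ, hs, -⟩
          simp [hvdef] at hs
        rw [ind_false hns]
        simp only [sub_self, zero_apply, abs_zero]
        rcases hu.lt_or_eq with h | h
        · have := hεlt h
          have := hεpos (Encodable.encode (ρ, ([] : List ℕ)))
          linarith
        · rw [h]
          have := hεpos (Encodable.encode (ρ, ([] : List ℕ)))
          linarith
      | cons k p ih =>
        intro hu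
        rcases hu.lt_or_eq with h | h
        · have hne : v ≠ (ρ, k :: p) := by
            rintro h'
            rw [h'] at h
            exact lt_irrefl _ h
          have hstep := (h3 ρ k p v h).2
          have hind : ind (v.1 = ρ ∧ v.2 <:+ k :: p ∧ lv v) = ind (v.1 = ρ ∧ v.2 <:+ p ∧ lv v) := by
            apply ind_congr
            constructor
            · rintro ⟨e1, e2, e3⟩
              refine ⟨e1, ?_, e3⟩
              rcases List.suffix_cons_iff.1 e2 with e2 | e2
              · exact absurd (Prod.ext e1 e2) hne
              · exact e2
            · rintro ⟨e1, e2, e3⟩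
              exact ⟨e1, e2.trans (List.suffix_cons _ _), e3⟩
          rw [hind]
          have htri : |(fn (st (ρ, k :: p)) - fn (st (ρ, []))) (vec (st v)) -
              ind (v.1 = ρ ∧ v.2 <:+ p ∧ lv v)| ≤
              |fn (st (ρ, k :: p)) (vec (st v)) - fn (st (ρ, p)) (vec (st v))| +
              |(fn (st (ρ, p)) - fn (st (ρ, []))) (vec (st v)) - ind (v.1 = ρ ∧ v.2 <:+ p ∧ lv v)| := by
            refine le_trans (le_of_eq ?_) (abs_add_le _ _)
            simp only [sub_apply]
            congr 1
            ring
          have hstep' : |fn (st (ρ, k :: p)) (vec (st v)) - fn (st (ρ, p)) (vec (st v))| ≤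
            ε (Encodable.encode (ρ, k :: p)) := hstep
          rcases lt_or_ge (Encodable.encode (ρ, p)) (Encodable.encode v) with hp | hp
          · have := hearly p hp
            have := hεlt h
            linarith
          · have := ih hp
            have := hεlt (encode_pair_tail_lt ρ k p)
            linarith
        · have heq : v = (ρ, k :: p) := Encodable.encode_injective h
          have hρ : ρ' = ρ := congrArg Prod.fst heq
          have hs : (v.1 = ρ ∧ v.2 <:+ k :: p ∧ lv v) := by
            refine ⟨hρ, ?_, hv⟩
            rw [heq]
          rw [ind_true hs, ← heq, sub_apply, lv1 v hv]
          have e2 := hsmall (ρ, []) (by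
            rw [heq]
            exact (encode_pair_nil_le ρ p).trans_lt (encode_pair_tail_lt ρ k p))
          have : (1 : ℝ) - fn (st (ρ, [])) (vec (st v)) - 1 = - fn (st (ρ, [])) (vec (st v)) := by ring
          rw [this, abs_neg]
          have := hεpos (Encodable.encode v)
          linarith
    have h8 : 3 * ε (Encodable.encode v) = (1 / 8) * (1 / 2) ^ (Encodable.encode v) := by
      simp only [hεdef]; ring
    rw [← h8]
    rcases lt_or_ge (Encodable.encode (ρ, u)) (Encodable.encode v) with hp | hp
    · have := hearly u hp
      have := hεpos (Encodable.encode v)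
      linarith
    · have := hlate u hp
      have := hεpos (Encodable.encode (ρ, u))
      linarith
  -- summation
  set N := ‖lc (fun v => vec (st v)) a‖ with hN
  have hD0 : 0 ≤ D := (norm_nonneg _).trans (hD (s []))
  have sumest : ∀ A, 0 ≤ A → (∀ v, lv v → |a v| ≤ A) → ∀ ρ u,
      |lc (fun v => ind (v.1 = ρ ∧ v.2 <:+ u ∧ lv v)) a| ≤ 2 * D * N + A / 4 := by
    intro A hA0 hA ρ u
    have e1 : |lc (fun v => (fn (st (ρ, u)) - fn (st (ρ, []))) (vec (st v))) a| ≤ 2 * D * N := by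
      have := lc_map (fn (st (ρ, u)) - fn (st (ρ, []))).toLinearMap (fun v => vec (st v)) a
      simp only [ContinuousLinearMap.coe_coe] at this
      rw [← this, ← Real.norm_eq_abs]
      refine (ContinuousLinearMap.le_opNorm _ _).trans ?_
      have h5 : ‖fn (st (ρ, u)) - fn (st (ρ, []))‖ ≤ 2 * D := by
        have := norm_sub_le (fn (st (ρ, u))) (fn (st (ρ, [])))
        have := hD (st (ρ, u))
        have := hD (st (ρ, []))
        linarith
      gcongr
    have e2 : |lc (fun v => (fn (st (ρ, u)) - fn (st (ρ, []))) (vec (st v)) -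
        ind (v.1 = ρ ∧ v.2 <:+ u ∧ lv v)) a| ≤ A / 4 := by
      rw [lc_eq_sum]
      refine (Finset.abs_sum_le_sum_abs _ _).trans ?_
      have : ∀ v ∈ a.support, |a v • ((fn (st (ρ, u)) - fn (st (ρ, []))) (vec (st v)) -
        ind (v.1 = ρ ∧ v.2 <:+ u ∧ lv v))| ≤ (A / 8) * (1 / 2) ^ (Encodable.encode v) := by
        intro v _
        by_cases hv : lv v
        · rw [smul_eq_mul, abs_mul]
          have h5 := est ρ u v hv
          calc _ ≤ A * ((1 / 8) * (1 / 2) ^ (Encodable.encode v)) := 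
                mul_le_mul (hA v hv) h5 (abs_nonneg _) hA0
            _ = _ := by ring
        · rw [lv2 v hv, ind_false (fun h => hv h.2.2)]
          simp only [map_zero, sub_zero, smul_zero, abs_zero]
          positivity
      refine (Finset.sum_le_sum this).trans ?_
      rw [← Finset.mul_sum]
      have := sum_half_encode a.support
      nlinarith
    rw [lc_fun_sub] at e2
    have := abs_sub_abs_le_abs_sub (lc (fun v => ind (v.1 = ρ ∧ v.2 <:+ u ∧ lv v)) a)
      (lc (fun v => (fn (st (ρ, u)) - fn (st (ρ, []))) (vec (st v))) a)
    rw [abs_sub_comm] at this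
    linarith
  have hcoef : ∀ v, lv v → ∃ ρ u u', |a v| ≤ |lc (fun v => ind (v.1 = ρ ∧ v.2 <:+ u ∧ lv v)) a| +
      |lc (fun v => ind (v.1 = ρ ∧ v.2 <:+ u' ∧ lv v)) a| := by
    rintro ⟨ρ, w⟩ hv
    rcases w with _ | ⟨k, p⟩
    · exact absurd hv (lv0 _)
    refine ⟨ρ, k :: p, p, ?_⟩
    refine le_trans (le_of_eq ?_) (abs_sub _ _)
    rw [← lc_fun_sub, ← lc_ind_eq a (ρ, k :: p)]
    congr 2
    funext v
    by_cases h : v = (ρ, k :: p)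
    · have h5 : v.1 = ρ ∧ v.2 <:+ k :: p ∧ lv v := ⟨by rw [h], by rw [h], h ▸ hv⟩
      have h6 : ¬ (v.1 = ρ ∧ v.2 <:+ p ∧ lv v) := by
        rintro ⟨-, h', -⟩
        rw [h] at h'
        have := h'.length_le
        simp at this
      rw [ind_true h, ind_true h5, ind_false h6, sub_zero]
    · rw [ind_false h, eq_comm, sub_eq_zero]
      apply ind_congr
      constructor
      · rintro ⟨e1, e2, e3⟩
        refine ⟨e1, ?_, e3⟩
        rcases List.suffix_cons_iff.1 e2 with e2 | e2
        · exact absurd (Prod.ext e1 e2) h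
        · exact e2
      · rintro ⟨e1, e2, e3⟩
        exact ⟨e1, e2.trans (List.suffix_cons _ _), e3⟩
  have hN0 : 0 ≤ N := norm_nonneg _
  have hmax : ∀ v, lv v → |a v| ≤ 8 * D * N := by
    classical
    by_contra hcon
    push Not at hcon
    obtain ⟨v0, hv0, hlt⟩ := hcon
    have hDN : 0 ≤ 8 * D * N := by positivity
    have hne : (a.support.filter lv).Nonempty := by
      refine ⟨v0, Finset.mem_filter.2 ⟨Finsupp.mem_support_iff.2 ?_, hv0⟩⟩
      intro h
      rw [h, abs_zero] at hlt
      linarith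
    obtain ⟨v1, hv1, hv1m⟩ := Finset.exists_max_image _ (fun v => |a v|) hne
    have hA : ∀ v, lv v → |a v| ≤ |a v1| := by
      intro v hv
      by_cases h0 : a v = 0
      · rw [h0, abs_zero]; positivity
      · exact hv1m v (Finset.mem_filter.2 ⟨Finsupp.mem_support_iff.2 h0, hv⟩)
    obtain ⟨ρ, u, u', hc⟩ := hcoef v1 (Finset.mem_filter.1 hv1).2
    have e1 := sumest _ (abs_nonneg _) hA ρ u
    have e2 := sumest _ (abs_nonneg _) hA ρ u'
    have := hA v0 hv0
    linarith
  intro ρ u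
  have := sumest _ (by positivity) hmax ρ u
  linarith

end

end ElU

namespace ElU

open Filter Topology

section
variable {X I J : Type} [NormedAddCommGroup X] [NormedSpace ℝ X]

/-- Block family over the tree of all finite sequences. -/
noncomputable def Psi (ψ : ℕ → J → I → ℝ) : List ℕ × J → List ℕ × I → ℝ :=
  fun q r => ind (r.1 = q.1) * ψ q.1.length q.2 r.2

/-- Upper estimate along branches inside `S`. -/
def UU (ψ : ℕ → J → I → ℝ) (A : Set (List ℕ × I →₀ ℝ)) (S : List ℕ → Prop) (C : ℝ)
    (x : List ℕ × I → X) : Prop :=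
  ∀ τ, S τ → ∀ a ∈ A, (∀ r, a r ≠ 0 → S r.1 ∧ r.1 <:+ τ) → ∀ R, 0 ≤ R →
    (∀ q, |lc (Psi ψ q) a| ≤ R) → ‖lc x a‖ ≤ C * R

open Classical in
/-- Restriction of coefficients to a set of nodes. -/
noncomputable def filt (P : List ℕ → Prop) (a : List ℕ × I →₀ ℝ) : List ℕ × I →₀ ℝ :=
  a.filter (fun r => P r.1)

lemma filt_ne {P : List ℕ → Prop} {a : List ℕ × I →₀ ℝ} {r : List ℕ × I} (h : filt P a r ≠ 0) :
    P r.1 ∧ a r ≠ 0 := by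
  classical
  rw [filt, Finsupp.filter_apply] at h
  by_cases hP : P r.1
  · simp only [hP, if_true] at h
    exact ⟨hP, h⟩
  · simp [hP] at h

lemma filt_add (P : List ℕ → Prop) (a : List ℕ × I →₀ ℝ) :
    a = filt P a + filt (fun ρ => ¬ P ρ) a := by
  classical
  ext r
  by_cases hP : P r.1 <;> simp [filt, Finsupp.filter_apply, hP]

lemma lc_Psi_filter (ψ : ℕ → J → I → ℝ) (P : List ℕ → Prop) (a : List ℕ × I →₀ ℝ)
    (q : List ℕ × J) :
    |lc (Psi ψ q) (filt P a)| ≤ |lc (Psi ψ q) a| := by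
  by_cases h : P q.1
  · apply le_of_eq
    congr 1
    have : a = filt P a + filt (fun ρ => ¬ P ρ) a :=
      filt_add _ a
    conv_rhs => rw [this, lc_add]
    have h0 : lc (Psi ψ q) (filt (fun ρ => ¬ P ρ) a) = 0 := by
      rw [← lc_const_zero (I := List ℕ × I) (X := ℝ) (filt (fun ρ => ¬ P ρ) a)]
      apply lc_congr
      intro r hr
      have hP : ¬ P r.1 := by
        exact (filt_ne hr).1
      have : r.1 ≠ q.1 := fun h' => hP (h' ▸ h)
      simp [Psi, ind_false this]
    rw [h0, add_zero]
  · have h0 : lc (Psi ψ q) (filt P a) = 0 := by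
      rw [← lc_const_zero (I := List ℕ × I) (X := ℝ) (filt P a)]
      apply lc_congr
      intro r hr
      have hP : P r.1 := by
        exact (filt_ne hr).1
      have : r.1 ≠ q.1 := fun h' => h (h' ▸ hP)
      simp [Psi, ind_false this]
    rw [h0, abs_zero]
    positivity

lemma lc_Psi_mapDomain (ψ : ℕ → J → I → ℝ) (ρ : List ℕ) (j : J) (a : I →₀ ℝ) :
    lc (Psi ψ (ρ, j)) (a.mapDomain (fun i => (ρ, i))) = lc (ψ ρ.length j) a := by
  rw [lc_mapDomain]
  apply lc_congr
  intro i _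
  simp [Psi, ind_true]

lemma Lower.single {ψ : ℕ → J → I → ℝ} {x : List ℕ × I → X} {c : ℝ} (h : Lower (Psi ψ) x c)
    (ρ : List ℕ) : Lower (ψ ρ.length) (fun i => x (ρ, i)) c := by
  intro a j
  have := h (a.mapDomain (fun i => (ρ, i))) (ρ, j)
  rwa [lc_Psi_mapDomain, lc_mapDomain] at this

lemma Lower.mono {ψ : J → I → ℝ} {x : I → X} {c c' : ℝ} (h : Lower ψ x c) (hc : c ≤ c') :
    Lower ψ x c' := fun a j => (h a j).trans (by gcongr)

lemma UU.mono {ψ : ℕ → J → I → ℝ} {A : Set (List ℕ × I →₀ ℝ)} {S : List ℕ → Prop} {C C' : ℝ}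
    {x : List ℕ × I → X} (h : UU ψ A S C x) (hC : C ≤ C') : UU ψ A S C' x :=
  fun τ hτ a ha hs R hR hq => (h τ hτ a ha hs R hR hq).trans (by gcongr)

/-- Restricting to a single node and congruence. -/
lemma UU.sub {ψ : ℕ → J → I → ℝ} {A : Set (List ℕ × I →₀ ℝ)} {S S' : List ℕ → Prop} {C : ℝ}
    {x x' : List ℕ × I → X} (h : UU ψ A S C x) (hS : ∀ ρ, S' ρ → S ρ)
    (hx : ∀ ρ i, S' ρ → x' (ρ, i) = x (ρ, i)) : UU ψ A S' C x' := by
  intro τ hτ a ha hs R hR hq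
  have : lc x' a = lc x a := lc_congr fun r hr => hx r.1 r.2 (hs r hr).1
  rw [this]
  exact h τ (hS τ hτ) a ha (fun r hr => ⟨hS _ (hs r hr).1, (hs r hr).2⟩) R hR hq

open Classical in
/-- Lemma D (tree induction). -/
lemma tree_induction [CompleteSpace X] {K : ℝ} (hK : IsKElastic X K) (hK1 : 1 ≤ K)
    (ψ : ℕ → J → I → ℝ) (hb : ∀ k i, ∃ B, ∀ j, |ψ k j i| ≤ B)
    (A : Set (List ℕ × I →₀ ℝ))
    (hA : ∀ a ∈ A, ∀ P : List ℕ → Prop, filt P a ∈ A)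
    (x0 : List ℕ × I → X) (c0 C0 : ℝ) (hC0 : 0 ≤ C0)
    (hL0 : ∀ ρ : List ℕ, Lower (ψ ρ.length) (fun i => x0 (ρ, i)) c0)
    (hU0 : ∀ ρ : List ℕ, UU ψ A (fun σ => σ = ρ) C0 x0)
    (HF : ∀ (y : List ℕ × I → X) (c C : ℝ), 0 ≤ c → 0 ≤ C →
      (∀ ρ : List ℕ, Lower (ψ ρ.length) (fun i => y (ρ, i)) c) →
      (∀ ρ : List ℕ, UU ψ A (fun σ => σ = ρ) C y) →
      ∃ (z : List ℕ × I → X) (c' : ℝ), Lower (Psi ψ) z c' ∧ ∀ S C', 0 ≤ C' → UU ψ A S C' y → UU ψ A S (2 * C') z)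
    (T : List ℕ → Prop) (hT0 : T []) (hTs : ∀ n τ, T (n :: τ) → T τ)
    (hW : WellFounded (ExtRel T)) :
    ∃ x : List ℕ × I → X, Lower (Psi ψ) x 1 ∧ UU ψ A T K x := by
  have hTsuf : ∀ ρ τ : List ℕ, ρ <:+ τ → T τ → T ρ := by
    intro ρ τ h
    induction τ with
    | nil => intro hτ; rwa [List.suffix_nil.1 h]
    | cons n τ ih =>
      intro hτ
      rcases List.suffix_cons_iff.1 h with h | h
      · rwa [h]
      · exact ih h (hTs _ _ hτ)
  have main : ∀ σ, T σ → ∃ x : List ℕ × I → X, Lower (Psi ψ) x 1 ∧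
      UU ψ A (fun ρ => T ρ ∧ σ <:+ ρ) K x := by
    intro σ
    induction σ using hW.induction with
    | _ σ ih =>
    intro hσ
    have hxs : ∀ n, ∃ x : List ℕ × I → X, T (n :: σ) → Lower (Psi ψ) x 1 ∧
        UU ψ A (fun ρ => T ρ ∧ (n :: σ) <:+ ρ) K x := by
      intro n
      by_cases h : T (n :: σ)
      · obtain ⟨x, hx⟩ := ih (n :: σ) ⟨h, n, rfl⟩ h
        exact ⟨x, fun _ => hx⟩
      · exact ⟨x0, fun h' => absurd h' h⟩
    choose xs hxs using hxs
    let y : List ℕ × I → X := fun r =>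
      if h : ∃ n, (n :: σ) <:+ r.1 ∧ T r.1 then xs h.choose r else x0 r
    have hy1 : ∀ n ρ i, (n :: σ) <:+ ρ → T ρ → y (ρ, i) = xs n (ρ, i) := by
      intro n ρ i h1 h2
      have h : ∃ n, (n :: σ) <:+ ρ ∧ T ρ := ⟨n, h1, h2⟩
      have : h.choose = n := by
        have e1 := suf_eq_of_suffix h.choose_spec.1
        have e2 := suf_eq_of_suffix h1
        simp only [List.length_cons] at e1 e2
        rw [e1] at e2
        exact (List.cons_eq_cons.1 e2).1
      simp only [y]
      rw [dif_pos h, this]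
    have hy2 : ∀ ρ i, (¬ ∃ n, (n :: σ) <:+ ρ ∧ T ρ) → y (ρ, i) = x0 (ρ, i) := by
      intro ρ i h
      simp only [y]
      rw [dif_neg h]
    have hyL : ∀ ρ : List ℕ, Lower (ψ ρ.length) (fun i => y (ρ, i)) (|c0| + 1) := by
      intro ρ
      by_cases h : ∃ n, (n :: σ) <:+ ρ ∧ T ρ
      · obtain ⟨n, h1, h2⟩ := h
        have e : (fun i => y (ρ, i)) = fun i => xs n (ρ, i) := by
          funext i
          exact hy1 n ρ i h1 h2
        rw [e]
        exact ((hxs n (hTsuf _ _ h1 h2)).1.single ρ).mono (by linarith [abs_nonneg c0])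
      · have e : (fun i => y (ρ, i)) = fun i => x0 (ρ, i) := by
          funext i
          exact hy2 ρ i h
        rw [e]
        exact (hL0 ρ).mono (by linarith [le_abs_self c0])
    have hyU : ∀ ρ : List ℕ, UU ψ A (fun σ => σ = ρ) (C0 + K) y := by
      intro ρ
      by_cases h : ∃ n, (n :: σ) <:+ ρ ∧ T ρ
      · obtain ⟨n, h1, h2⟩ := h
        refine ((hxs n (hTsuf _ _ h1 h2)).2.sub ?_ ?_).mono (by linarith)
        · rintro _ rfl
          exact ⟨h2, h1⟩
        · rintro _ i rfl
          exact hy1 n _ i h1 h2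
      · refine ((hU0 ρ).sub (S' := fun σ => σ = ρ) ?_ ?_).mono (by linarith)
        · exact fun _ h => h
        · rintro _ i rfl
          exact hy2 _ i h
    have hyUU : UU ψ A (fun ρ => T ρ ∧ σ <:+ ρ) (C0 + K) y := by
      intro τ hτ a ha hs R hR hq
      set a1 := filt (fun ρ => ρ = σ) a with ha1
      set a2 := filt (fun ρ => ¬ ρ = σ) a with ha2
      have hsum : a = a1 + a2 := filt_add _ a
      have hns : ¬ ∃ n, (n :: σ) <:+ σ ∧ T σ := by
        rintro ⟨n, h, -⟩
        have := h.length_le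
        simp at this
      have e1 : ‖lc y a1‖ ≤ C0 * R := by
        have hx : lc y a1 = lc x0 a1 := by
          apply lc_congr
          rintro ⟨ρ, i⟩ hr
          have : ρ = σ := by
            exact (filt_ne hr).1
          rw [this]
          exact hy2 σ i hns
        rw [hx]
        apply hU0 σ σ rfl a1 (hA a ha (fun ρ => ρ = σ))
        · intro r hr
          have : r.1 = σ := by
            exact (filt_ne hr).1
          exact ⟨this, this ▸ List.suffix_refl _⟩
        · exact hR
        · exact fun q => (lc_Psi_filter ψ (fun ρ => ρ = σ) a q).trans (hq q)
      have e2 : ‖lc y a2‖ ≤ K * R := by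
        have ha2' : ∀ r, a2 r ≠ 0 → r.1 ≠ σ ∧ a r ≠ 0 := by
          exact fun r hr => filt_ne hr
        have hcons : ∀ ρ, σ <:+ ρ → ρ ≠ σ → ∃ n, (n :: σ) <:+ ρ := by
          rintro ρ ⟨t, rfl⟩ hne
          rcases List.eq_nil_or_concat t with h | ⟨t', n, h⟩
          · subst h
            simp at hne
          · refine ⟨n, t', ?_⟩
            rw [h]
            simp
        by_cases hτσ : τ = σ
        · have : a2 = 0 := by
            ext r
            by_contra hr
            obtain ⟨h1, h2⟩ := ha2' r hr
            have h3 := hs r h2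
            rw [hτσ] at h3
            exact h1 (h3.2.eq_of_length_le h3.1.2.length_le)
          rw [this, lc_zero, norm_zero]
          positivity
        · obtain ⟨n, hn⟩ := hcons τ hτ.2 hτσ
          have hnT := hTsuf _ _ hn hτ.1
          have hext : ∀ r, a2 r ≠ 0 → (T r.1 ∧ (n :: σ) <:+ r.1) ∧ r.1 <:+ τ := by
            intro r hr
            obtain ⟨h1, h2⟩ := ha2' r hr
            have h3 := hs r h2
            obtain ⟨n', hn'⟩ := hcons r.1 h3.1.2 h1
            have e1 := suf_eq_of_suffix hn
            have e2 := suf_eq_of_suffix (hn'.trans h3.2)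
            simp only [List.length_cons] at e1 e2
            rw [e1] at e2
            rw [e2]
            exact ⟨⟨h3.1.1, hn'⟩, h3.2⟩
          have hx : lc y a2 = lc (xs n) a2 := by
            apply lc_congr
            rintro ⟨ρ, i⟩ hr
            exact hy1 n ρ i (hext _ hr).1.2 (hext _ hr).1.1
          rw [hx]
          apply (hxs n hnT).2 τ ⟨hτ.1, hn⟩ a2 (hA a ha (fun ρ => ¬ ρ = σ)) hext R hR
          exact fun q => (lc_Psi_filter ψ (fun ρ => ¬ ρ = σ) a q).trans (hq q)
      rw [hsum, lc_add]
      refine (norm_add_le _ _).trans ?_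
      rw [add_mul]
      exact add_le_add e1 e2
    obtain ⟨z, c', hzL, hzU⟩ := HF y (|c0| + 1) (C0 + K) (by positivity) (by linarith) hyL hyU
    have hzUU := hzU _ _ (by linarith) hyUU
    set M := 2 * (C0 + K) with hM
    have hMpos : 0 < M := by linarith
    let χ : (List ℕ × J) ⊕ {f : StrongDual ℝ X // ‖f‖ ≤ 1} → List ℕ × I → ℝ := fun w r =>
      Sum.elim (fun q => Psi ψ q r) (fun f => M⁻¹ * f.1 (z r)) w
    have hχr : ∀ f a, lc (χ (Sum.inr f)) a = M⁻¹ * f.1 (lc z a) := by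
      intro f a
      have := lc_map f.1.toLinearMap z a
      simp only [ContinuousLinearMap.coe_coe] at this
      rw [this, lc_eq_sum, lc_eq_sum, Finset.mul_sum]
      apply Finset.sum_congr rfl
      intro r _
      simp only [χ, Sum.elim_inr, smul_eq_mul]
      ring
    have hχl : ∀ q a, lc (χ (Sum.inl q)) a = lc (Psi ψ q) a := fun q a => rfl
    have hfz : ∀ (f : {f : StrongDual ℝ X // ‖f‖ ≤ 1}) v, |f.1 v| ≤ ‖v‖ := by
      intro f v
      have := f.1.le_of_opNorm_le f.2 v
      simpa using this
    obtain ⟨x, hxL, hxU⟩ := elastic_good hK hK1 χ (by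
      rintro ⟨ρ, i⟩
      obtain ⟨B, hB⟩ := hb ρ.length i
      refine ⟨|B| + M⁻¹ * ‖z (ρ, i)‖, ?_⟩
      rintro (⟨ρ', j⟩ | f)
      · have h1 : |Psi ψ (ρ', j) (ρ, i)| ≤ |B| := by
          by_cases h : ρ = ρ'
          · subst h
            simp only [Psi, ind_true, one_mul]
            exact (hB j).trans (le_abs_self B)
          · simp [Psi, ind_false h]
        have h2 : 0 ≤ M⁻¹ * ‖z (ρ, i)‖ := by positivity
        change |Psi ψ (ρ', j) (ρ, i)| ≤ _
        linarith
      · change |M⁻¹ * f.1 (z (ρ, i))| ≤ _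
        rw [abs_mul, abs_of_pos (inv_pos.2 hMpos)]
        have := hfz f (z (ρ, i))
        have : M⁻¹ * |f.1 (z (ρ, i))| ≤ M⁻¹ * ‖z (ρ, i)‖ := by gcongr
        linarith [abs_nonneg B]) z (|c'| + M⁻¹) M (by
      rintro a (q | f)
      · rw [hχl]
        refine (hzL a q).trans ?_
        gcongr
        have := inv_pos.2 hMpos
        linarith [le_abs_self c']
      · rw [hχr, abs_mul, abs_of_pos (inv_pos.2 hMpos)]
        have : M⁻¹ * |f.1 (lc z a)| ≤ M⁻¹ * ‖lc z a‖ := by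
          gcongr
          exact hfz _ _
        have h2 : 0 ≤ |c'| * ‖lc z a‖ := by positivity
        linarith) (by
      intro a R hR hq
      obtain ⟨f, hf1, hf2⟩ := exists_dual_vector'' ℝ (lc z a)
      have := hq (Sum.inr ⟨f, hf1⟩)
      rw [hχr, abs_mul, abs_of_pos (inv_pos.2 hMpos), inv_mul_le_iff₀ hMpos] at this
      simp only [hf2] at this
      simpa using this)
    refine ⟨x, fun a q => hxL a (Sum.inl q), ?_⟩
    intro τ hτ a ha hs R hR hq
    apply hxU a R hR
    rintro (q | f)
    · exact hq q
    · rw [hχr, abs_mul, abs_of_pos (inv_pos.2 hMpos), inv_mul_le_iff₀ hMpos]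
      exact (hfz _ _).trans (hzUU τ hτ a ha hs R hR hq)
  obtain ⟨x, hx1, hx2⟩ := main [] hT0
  exact ⟨x, hx1, hx2.sub (fun ρ h => ⟨h, List.nil_suffix⟩) (fun _ _ _ => rfl)⟩

end

end ElU

namespace ElU

open Filter Topology

section
variable {X : Type} [NormedAddCommGroup X] [NormedSpace ℝ X]

lemma weakstar_subseq [TopologicalSpace.SeparableSpace X] (f : ℕ → StrongDual ℝ X) (D : ℝ)
    (hf : ∀ i, ‖f i‖ ≤ D) :
    ∃ θ : StrongDual ℝ X, ‖θ‖ ≤ D ∧ ∃ m : ℕ → ℕ, StrictMono m ∧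
      ∀ x, Tendsto (fun i => f (m i) x) atTop (𝓝 (θ x)) := by
  have h := WeakDual.isSeqCompact_closedBall ℝ X 0 D
  obtain ⟨θ, hθ, m, hm, ht⟩ := h (x := fun i => StrongDual.toWeakDual (f i)) (fun i => by
    simpa using hf i)
  refine ⟨WeakDual.toStrongDual θ, by simpa using hθ, m, hm, fun x => ?_⟩
  exact ((WeakDual.eval_continuous x).tendsto θ).comp ht

lemma diag_subseq (φ : ℕ → StrongDual ℝ X) (y : ℕ → X) (B : ℝ) (hy : ∀ i, ‖y i‖ ≤ B) :
    ∃ m : ℕ → ℕ, StrictMono m ∧ ∀ n, ∃ l, Tendsto (fun i => φ n (y (m i))) atTop (𝓝 l) := by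
  have hc : IsCompact (Set.pi Set.univ fun n => Set.Icc (-(‖φ n‖ * B)) (‖φ n‖ * B)) :=
    isCompact_univ_pi fun n => isCompact_Icc
  obtain ⟨l, -, m, hm, ht⟩ := hc.tendsto_subseq (x := fun i n => φ n (y i)) (by
    intro i n _
    rw [Set.mem_Icc, ← abs_le]
    refine ((φ n).le_opNorm (y i)).trans ?_
    gcongr
    exact hy i)
  refine ⟨m, hm, fun n => ⟨l n, ?_⟩⟩
  rw [tendsto_pi_nhds] at ht
  exact ht n

/-- Exists a bounded triangular system. -/
lemma exists_triangular (hinf : ¬ FiniteDimensional ℝ X) :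
    ∃ (x : ℕ → X) (f : ℕ → StrongDual ℝ X), (∀ i, ‖x i‖ ≤ 3) ∧ (∀ i, ‖f i‖ ≤ 1) ∧
      (∀ i, f i (x i) = 1) ∧ ∀ i j, j < i → f i (x j) = 0 := by
  classical
  have : Nonempty (X × StrongDual ℝ X) := ⟨0⟩
  let R : ℕ → (ℕ → X × StrongDual ℝ X) → X × StrongDual ℝ X → Prop := fun c h s =>
    ‖s.1‖ ≤ 3 ∧ ‖s.2‖ ≤ 1 ∧ s.2 s.1 = 1 ∧ ∀ m, m < c → s.2 (h m).1 = 0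
  obtain ⟨g, hg⟩ := exists_seq_of_forall R (by
    rintro c h h' s hh ⟨h1, h2, h3, h4⟩
    refine ⟨h1, h2, h3, fun m hm => ?_⟩
    rw [← hh m hm]
    exact h4 m hm) (by
    intro c h
    let F : Submodule ℝ X := Submodule.span ℝ (((Finset.range c).image (fun m => (h m).1) : Finset X) : Set X)
    have hfd : FiniteDimensional ℝ F := FiniteDimensional.span_finset ℝ _
    have hF : IsClosed (F : Set X) := F.closed_of_finiteDimensional
    have hne : ∃ x, x ∉ F := by
      by_contra hcon
      push Not at hcon
      apply hinf
      have : F = ⊤ := by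
        ext x; simp [hcon x]
      rw [this] at hfd
      exact Module.Finite.equiv (Submodule.topEquiv (R := ℝ) (M := X))
    obtain ⟨x, hx1, hx2⟩ := riesz_lemma_of_norm_lt (c := (2 : ℝ)) (R := 3) (by norm_num) (by norm_num) hF hne
    obtain ⟨f, hf1, hf2⟩ := hb_functional (I := Option F) (fun o => Option.elim o 1 (fun _ => 0))
      (fun o => Option.elim o x (fun v => (v : X))) 1 zero_le_one (by
      intro a
      have hsome : ∀ {Z : Type} [AddCommGroup Z] [Module ℝ Z] (w : Option F → Z),
          lc w a = a none • w none + lc (fun v : F => w (some v)) a.some := by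
        intro Z _ _ w
        simp only [lc]
        rw [Finsupp.linearCombination_option]
        rfl
      rw [hsome, hsome, one_mul]
      simp only [Option.elim]
      rw [lc_const_zero]
      have hmem : lc (fun v : F => (v : X)) a.some ∈ F := by
        rw [lc_eq_sum]
        exact Submodule.sum_mem _ fun v _ => F.smul_mem _ v.2
      set v := lc (fun v : F => (v : X)) a.some
      set t := a none
      simp only [smul_eq_mul, mul_one, add_zero]
      by_cases ht : t = 0
      · rw [ht, abs_zero]; positivity
      · have h5 := hx2 (-(t⁻¹ • v)) (F.neg_mem (F.smul_mem _ hmem))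
        have : t • x + v = t • (x - -(t⁻¹ • v)) := by
          rw [sub_neg_eq_add, smul_add, smul_smul, mul_inv_cancel₀ ht, one_smul]
        rw [this, norm_smul, Real.norm_eq_abs]
        have := abs_nonneg t
        nlinarith)
    refine ⟨(x, f), hx1, hf1, hf2 none, fun m hm => ?_⟩
    exact hf2 (some ⟨(h m).1, Submodule.subset_span (by
      simp only [Finset.coe_image, Set.mem_image]
      exact ⟨m, by simpa using hm, rfl⟩)⟩))
  exact ⟨fun i => (g i).1, fun i => (g i).2, fun i => (hg i).1, fun i => (hg i).2.1,
    fun i => (hg i).2.2.1, fun i j hj => (hg i).2.2.2 j hj⟩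

/-- Fusion of countably many sequences. -/
lemma fuse_seq [TopologicalSpace.SeparableSpace X] (y : List ℕ × ℕ → X)
    (f : List ℕ × ℕ → StrongDual ℝ X) (B D : ℝ) (hy : ∀ r, ‖y r‖ ≤ B) (hf : ∀ r, ‖f r‖ ≤ D)
    (h1 : ∀ r, f r (y r) = 1) (h0 : ∀ ρ i j, j < i → f (ρ, i) (y (ρ, j)) = 0) :
    ∃ s1 s2 : List ℕ × ℕ → ℕ, ∀ (a : List ℕ × ℕ →₀ ℝ) r,
      |a r| ≤ 4 * D * ‖lc (fun r => y (r.1, s1 r) - y (r.1, s2 r)) a‖ := by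
  have hw : ∀ ρ : List ℕ, ∃ θ : StrongDual ℝ X, ‖θ‖ ≤ D ∧ ∃ m : ℕ → ℕ, StrictMono m ∧
      ∀ x, Tendsto (fun i => f (ρ, m i) x) atTop (𝓝 (θ x)) := fun ρ =>
    weakstar_subseq (fun i => f (ρ, i)) D (fun i => hf _)
  choose θ hθ m hm ht using hw
  obtain ⟨e⟩ : Nonempty (ℕ ≃ (List ℕ × ℕ) ⊕ List ℕ) := ⟨(Denumerable.eqv _).symm⟩
  have hd : ∀ ρ : List ℕ, ∃ m' : ℕ → ℕ, StrictMono m' ∧ ∀ n, ∃ l,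
      Tendsto (fun i => (Sum.elim f θ (e n)) (y (ρ, m ρ (m' i)))) atTop (𝓝 l) := fun ρ =>
    diag_subseq (fun n => Sum.elim f θ (e n)) (fun i => y (ρ, m ρ i)) B (fun i => hy _)
  choose m' hm' hl using hd
  let μ : List ℕ → ℕ → ℕ := fun ρ i => m ρ (m' ρ i)
  have hμ : ∀ ρ, StrictMono (μ ρ) := fun ρ => (hm ρ).comp (hm' ρ)
  have hlim : ∀ w ρ, Tendsto (fun j => (Sum.elim f θ w) (y (ρ, μ ρ (j + 1)) - y (ρ, μ ρ j))) atTop (𝓝 0) := by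
    intro w ρ
    obtain ⟨l, hl⟩ := hl ρ (e.symm w)
    simp only [Equiv.apply_symm_apply] at hl
    have h2 := (hl.comp (tendsto_add_atTop_nat 1)).sub hl
    rw [sub_self] at h2
    simpa using h2
  have hlim2 : ∀ ρ x, Tendsto (fun j => f (ρ, μ ρ (j + 1)) x) atTop (𝓝 (θ ρ x)) := by
    intro ρ x
    exact ((ht ρ x).comp (hm' ρ).tendsto_atTop).comp (tendsto_add_atTop_nat 1)
  let vec : List ℕ × Option (ℕ × Bool) → X := fun s => match s with
    | (_, none) => 0
    | (_, some (_, false)) => 0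
    | (ρ, some (j, true)) => y (ρ, μ ρ (j + 1)) - y (ρ, μ ρ j)
  let fn : List ℕ × Option (ℕ × Bool) → StrongDual ℝ X := fun s => match s with
    | (ρ, none) => θ ρ
    | (ρ, some (j, _)) => f (ρ, μ ρ (j + 1))
  let Opt : List ℕ × Option (ℕ × Bool) → ℕ → List ℕ × Option (ℕ × Bool) → Prop := fun s _ s' =>
    match s with
    | (ρ, none) => ∃ j, s' = (ρ, some (j, true))
    | (ρ, some (j, _)) => s' = (ρ, some (j, false))
  have hfn : ∀ s, ∃ w, fn s = Sum.elim f θ w := by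
    rintro ⟨ρ, _ | ⟨j, b⟩⟩
    · exact ⟨Sum.inr ρ, rfl⟩
    · exact ⟨Sum.inl (ρ, μ ρ (j + 1)), rfl⟩
  obtain ⟨st, hst0, hstO, hst⟩ := fusion vec fn D (by
    rintro ⟨ρ, _ | ⟨j, b⟩⟩
    · exact hθ ρ
    · exact hf _) Opt (by
    rintro ⟨ρ, _ | ⟨j, b⟩⟩ k
    · refine ⟨fun j => (ρ, some (j, true)), fun j => ⟨j, rfl⟩, fun s' => ?_, fun s' => ?_⟩
      · obtain ⟨w, hw⟩ := hfn s'
        rw [hw]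
        exact hlim w ρ
      · exact hlim2 ρ _
    · refine ⟨fun _ => (ρ, some (j, false)), fun _ => rfl, fun s' => ?_, fun s' => ?_⟩
      · simp [vec]
      · exact tendsto_const_nhds) (fun ρ => (ρ, none))
  have hst1 : ∀ ρ k, ∃ j, st (ρ, [k]) = (ρ, some (j, true)) := by
    intro ρ k
    have := hstO ρ k []
    rw [hst0] at this
    exact this
  have hst2 : ∀ ρ k k' p, ∃ j, st (ρ, k :: k' :: p) = (ρ, some (j, false)) := by
    intro ρ k k' p
    induction p generalizing k k' with
    | nil =>
      obtain ⟨j, hj⟩ := hst1 ρ k'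
      have := hstO ρ k [k']
      rw [hj] at this
      exact ⟨j, this⟩
    | cons k'' p ih =>
      obtain ⟨j, hj⟩ := ih k' k''
      have := hstO ρ k (k' :: k'' :: p)
      rw [hj] at this
      exact ⟨j, this⟩
  have hres := hst (fun v => v.2.length = 1) (by simp) (by
    rintro ⟨ρ, u⟩ hu
    obtain ⟨k, rfl⟩ := List.length_eq_one_iff.1 hu
    obtain ⟨j, hj⟩ := hst1 ρ k
    rw [hj]
    change f (ρ, μ ρ (j + 1)) (y (ρ, μ ρ (j + 1)) - y (ρ, μ ρ j)) = 1
    rw [map_sub, h1, h0 _ _ _ (hμ ρ (Nat.lt_succ_self j)), sub_zero]) (by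
    rintro ⟨ρ, u⟩ hu
    rcases u with _ | ⟨k, _ | ⟨k', p⟩⟩
    · rw [hst0]
    · simp at hu
    · obtain ⟨j, hj⟩ := hst2 ρ k k' p
      rw [hj])
  choose jj hjj using hst1
  refine ⟨fun r => μ r.1 (jj r.1 r.2 + 1), fun r => μ r.1 (jj r.1 r.2), fun a r => ?_⟩
  have h2 := hres (a.mapDomain (fun r => (r.1, [r.2]))) r.1 [r.2]
  rw [lc_mapDomain, lc_mapDomain] at h2
  have e1 : lc (fun i : List ℕ × ℕ => ind ((i.1, [i.2]).1 = r.1 ∧ (i.1, [i.2]).2 <:+ [r.2] ∧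
      (i.1, [i.2]).2.length = 1)) a = a r := by
    rw [← lc_ind_eq a r]
    congr 1
    funext i
    apply ind_congr
    constructor
    · rintro ⟨e1, e2, -⟩
      have := e2.eq_of_length_le (by simp)
      exact Prod.ext e1 (by simpa using this)
    · rintro rfl
      simp
  rw [e1] at h2
  have e2 : (fun i : List ℕ × ℕ => vec (st (i.1, [i.2]))) = fun r : List ℕ × ℕ =>
      y (r.1, μ r.1 (jj r.1 r.2 + 1)) - y (r.1, μ r.1 (jj r.1 r.2)) := by
    funext i
    rw [hjj]
  rw [e2] at h2
  exact h2

/-- The unit vector family. -/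
noncomputable def delta : ℕ → ℕ → ℝ := fun j i => ind (i = j)

lemma lc_delta (a : ℕ →₀ ℝ) (j : ℕ) : lc (delta j) a = a j := lc_ind_eq a j

lemma lc_Psi_delta (a : List ℕ × ℕ →₀ ℝ) (q : List ℕ × ℕ) :
    lc (Psi (fun _ => delta) q) a = a q := by
  rw [← lc_ind_eq a q]
  congr 1
  funext r
  by_cases h : r = q
  · subst h
    simp [Psi, delta, ind_true]
  · rw [ind_false h]
    by_cases h1 : r.1 = q.1
    · have : r.2 ≠ q.2 := fun h2 => h (Prod.ext h1 h2)
      simp [Psi, delta, ind_false this]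
    · simp [Psi, ind_false h1]

/-- At most one index per node. -/
def oneper : Set (List ℕ × ℕ →₀ ℝ) :=
  {a | ∀ ρ i j, a (ρ, i) ≠ 0 → a (ρ, j) ≠ 0 → i = j}

lemma mapDomain_ne {I J : Type} {g : I → J} {a : I →₀ ℝ} {j : J} (h : a.mapDomain g j ≠ 0) :
    ∃ i, g i = j ∧ a i ≠ 0 := by
  classical
  have := Finsupp.mapDomain_support (Finsupp.mem_support_iff.2 h)
  obtain ⟨i, hi, rfl⟩ := Finset.mem_image.1 this
  exact ⟨i, rfl, Finsupp.mem_support_iff.1 hi⟩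

lemma mapDomain_inj_apply {I J : Type} {g : I → J} {a : I →₀ ℝ}
    (hg : ∀ i i', a i ≠ 0 → a i' ≠ 0 → g i = g i' → i = i') {i : I} (hi : a i ≠ 0) :
    a.mapDomain g (g i) = a i :=
  Finsupp.mapDomain_apply' {i | a i ≠ 0} a (fun i hi => Finsupp.mem_support_iff.1 hi)
    (fun i hi i' hi' h => hg i i' hi hi' h) hi

lemma uu_double (y : List ℕ × ℕ → X) (s1 s2 : List ℕ × ℕ → ℕ) (S : List ℕ → Prop) (C : ℝ)
    (hU : UU (fun _ => delta) oneper S C y) :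
    UU (fun _ => delta) oneper S (2 * C) (fun r => y (r.1, s1 r) - y (r.1, s2 r)) := by
  have key : ∀ s : List ℕ × ℕ → ℕ, UU (fun _ => delta) oneper S C (fun r => y (r.1, s r)) := by
    intro s τ hτ a ha hs R hR hq
    rw [← lc_mapDomain (fun r : List ℕ × ℕ => (r.1, s r)) y a]
    have hinj : ∀ i i' : List ℕ × ℕ, a i ≠ 0 → a i' ≠ 0 → (i.1, s i) = (i'.1, s i') → i = i' := by
      rintro ⟨ρ, i⟩ ⟨ρ', i'⟩ h h' he
      obtain ⟨rfl, -⟩ := Prod.mk.inj he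
      rw [ha ρ i i' h h']
    apply hU τ hτ _ _ _ R hR
    · intro q
      rw [lc_Psi_delta]
      by_cases h : a.mapDomain (fun r : List ℕ × ℕ => (r.1, s r)) q = 0
      · rw [h, abs_zero]; exact hR
      · obtain ⟨i, rfl, hi⟩ := mapDomain_ne h
        rw [mapDomain_inj_apply hinj hi, ← lc_Psi_delta]
        exact hq i
    · intro ρ i j hi hj
      obtain ⟨⟨ρ1, i'⟩, h1, hi'⟩ := mapDomain_ne hi
      obtain ⟨⟨ρ2, j'⟩, h2, hj'⟩ := mapDomain_ne hj
      obtain ⟨rfl, rfl⟩ := Prod.mk.inj h1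
      obtain ⟨h3, rfl⟩ := Prod.mk.inj h2
      simp only at h3
      subst h3
      rw [ha _ i' j' hi' hj']
    · intro r hr
      obtain ⟨i, rfl, hi⟩ := mapDomain_ne hr
      exact hs i hi
  intro τ hτ a ha hs R hR hq
  rw [lc_fun_sub]
  refine (norm_sub_le _ _).trans ?_
  have e1 := key s1 τ hτ a ha hs R hR hq
  have e2 := key s2 τ hτ a ha hs R hR hq
  linarith

lemma Upper.mono {I J : Type} {ψ : J → I → ℝ} {x : I → X} {C C' : ℝ} (h : Upper ψ x C) (hC : C ≤ C') :
    Upper ψ x C' := fun a R hR hj => (h a R hR hj).trans (by gcongr)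

/-- Stage 1: `c_0` is well embedded. -/
lemma good_delta [CompleteSpace X] [TopologicalSpace.SeparableSpace X] {K : ℝ}
    (hK : IsKElastic X K) (hK1 : 1 ≤ K) (hinf : ¬ FiniteDimensional ℝ X) : Good X delta K := by
  obtain ⟨x, f, hx, hf, hf1, hf0⟩ := exists_triangular hinf
  obtain ⟨s1, s2, hs⟩ := fuse_seq (fun r => x r.2) (fun r => f r.2) 3 1 (fun r => hx _) (fun r => hf _)
    (fun r => hf1 _) (fun ρ i j h => hf0 i j h)
  set x0 : List ℕ × ℕ → X := fun r => x (s1 r) - x (s2 r) with hx0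
  have hL0 : Lower (Psi fun _ => delta) x0 (4 * 1) := by
    intro a q
    rw [lc_Psi_delta]
    exact hs a q
  have hx0n : ∀ r, ‖x0 r‖ ≤ 6 := by
    intro r
    refine (norm_sub_le _ _).trans ?_
    have := hx (s1 r)
    have := hx (s2 r)
    linarith
  have htree : ∀ T : List ℕ → Prop, T [] → (∀ n τ, T (n :: τ) → T τ) → WellFounded (ExtRel T) →
      ∃ x : List ℕ × ℕ → X, Lower (Psi fun _ => delta) x 1 ∧ UU (fun _ => delta) oneper T K x := by
    intro T hT0 hTs hW
    apply tree_induction hK hK1 (fun _ => delta) (fun _ i => ⟨1, fun j => abs_ind_le _⟩) oneper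
      _ x0 (4 * 1) 6 (by norm_num) (fun ρ => hL0.single ρ) _ _ T hT0 hTs hW
    · intro a ha P ρ i j hi hj
      exact ha ρ i j (filt_ne hi).2 (filt_ne hj).2
    · intro ρ τ hτ a ha hs R hR hq
      by_cases h0 : a = 0
      · rw [h0, lc_zero, norm_zero]; positivity
      · obtain ⟨⟨ρ', i⟩, hi⟩ := Finsupp.ne_iff.1 h0
        have hi : a (ρ', i) ≠ 0 := hi
        have hρ' := (hs _ hi).1
        simp only at hρ'
        subst hρ'
        have : a = Finsupp.single (ρ', i) (a (ρ', i)) := by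
          ext ⟨ρ, j⟩
          by_cases hj : a (ρ, j) = 0
          · by_cases h : ((ρ', i) : List ℕ × ℕ) = (ρ, j)
            · rw [h] at hi
              exact absurd hj hi
            · rw [hj, Finsupp.single_apply, if_neg h]
          · have h := (hs _ hj).1
            simp only at h
            subst h
            rw [ha _ j i hj hi, Finsupp.single_eq_same]
        rw [this, lc_single, norm_smul, Real.norm_eq_abs]
        have h1 := hq (ρ', i)
        rw [lc_Psi_delta] at h1
        have := hx0n (ρ', i)
        have := norm_nonneg (x0 (ρ', i))
        nlinarith [abs_nonneg (a (ρ', i))]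
    · intro y c C hc hC hyL hyU
      have hyB : ∀ r, ‖y r‖ ≤ C := by
        rintro ⟨ρ, i⟩
        have h := hyU ρ ρ rfl (Finsupp.single (ρ, i) 1) (by
          intro ρ' i' j' h1 h2
          rw [Finsupp.single_apply_ne_zero] at h1 h2
          rw [(Prod.mk.inj h1.1).2, (Prod.mk.inj h2.1).2]) (by
          intro r hr
          rw [Finsupp.single_apply_ne_zero] at hr
          rw [hr.1]
          exact ⟨rfl, List.suffix_refl _⟩) 1 zero_le_one (by
          intro q
          rw [lc_Psi_delta, Finsupp.single_apply]
          split_ifs <;> simp)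
        rw [lc_single] at h
        simpa using h
      have hfun : ∀ r : List ℕ × ℕ, ∃ f : StrongDual ℝ X, ‖f‖ ≤ c ∧ ∀ i, f (y (r.1, i)) = delta r.2 i :=
        fun r => hb_functional (delta r.2) (fun i => y (r.1, i)) c hc (fun a => hyL r.1 a r.2)
      choose f hfn hfy using hfun
      obtain ⟨s1, s2, hs⟩ := fuse_seq y f C c hyB hfn (fun r => by
        have := hfy r r.2
        rwa [delta, ind_true rfl] at this) (fun ρ i j h => by
        have := hfy (ρ, i) j
        rwa [delta, ind_false (by simp only; omega)] at this)
      refine ⟨_, 4 * c, ?_, fun S C' _ h => uu_double y s1 s2 S C' h⟩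
      intro a q
      rw [lc_Psi_delta]
      exact hs a q
  obtain ⟨x, hxL, hxU⟩ := principle (X := X) K delta (fun _ => True) (fun m _ => ⟨1, fun a R hR h => by
      have := h m
      rw [lc_delta] at this
      linarith⟩) (by
    intro T hT0 hTs hW
    obtain ⟨x, hxL, hxU⟩ := htree T hT0 hTs hW
    have hTsuf : ∀ ρ τ : List ℕ, ρ <:+ τ → T τ → T ρ := by
      intro ρ τ h
      induction τ with
      | nil => intro hτ; rwa [List.suffix_nil.1 h]
      | cons n τ ih =>
        intro hτ
        rcases List.suffix_cons_iff.1 h with h | h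
        · rwa [h]
        · exact ih h (hTs _ _ hτ)
    refine ⟨fun τ => x (τ, 0), by simp, fun τ hτ a ha => ?_⟩
    have hle : ∀ m, a m ≠ 0 → m ≤ τ.length := fun m hm => by
      by_contra h
      exact hm (ha m (by omega))
    have hinj : ∀ m m', a m ≠ 0 → a m' ≠ 0 → ((suf τ m, 0) : List ℕ × ℕ) = (suf τ m', 0) → m = m' := by
      intro m m' hm hm' h
      have := congrArg List.length (Prod.mk.inj h).1
      rwa [suf_length (hle m hm), suf_length (hle m' hm')] at this
    rw [← lc_mapDomain (fun m => (suf τ m, 0)) x a]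
    constructor
    · intro j
      rw [lc_delta]
      by_cases hj : a j = 0
      · rw [hj, abs_zero]; positivity
      · have := hxL (a.mapDomain (fun m => (suf τ m, 0))) (suf τ j, 0)
        rw [lc_Psi_delta, mapDomain_inj_apply (g := fun m => (suf τ m, 0)) hinj hj, one_mul] at this
        exact this
    · intro R hR hj
      apply hxU τ hτ _ _ _ R hR
      · intro q
        rw [lc_Psi_delta]
        by_cases h : a.mapDomain (fun m => (suf τ m, 0)) q = 0
        · rw [h, abs_zero]; exact hR
        · obtain ⟨i, rfl, hi⟩ := mapDomain_ne h
          rw [mapDomain_inj_apply (g := fun m => (suf τ m, 0)) hinj hi, ← lc_delta]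
          exact hj i
      · intro ρ i j hi hj
        obtain ⟨m, h1, hi'⟩ := mapDomain_ne hi
        obtain ⟨m', h2, hj'⟩ := mapDomain_ne hj
        rw [← (Prod.mk.inj h1).2, ← (Prod.mk.inj h2).2]
      · intro r hr
        obtain ⟨m, rfl, hm⟩ := mapDomain_ne hr
        exact ⟨hTsuf _ _ (suf_suffix τ m) hτ, suf_suffix τ m⟩)
  exact elastic_good hK hK1 delta (fun i => ⟨1, fun j => abs_ind_le _⟩) x 2 (K + 1) hxL hxU

end

end ElU

namespace ElU

open Filter Topology

/-- Well-founded countably branching forests. -/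
inductive Fo : Type
  | empty : Fo
  | mk : (ℕ → Fo) → Fo

namespace Fo

def child : Fo → ℕ → Fo
  | empty, _ => empty
  | mk f, k => f k

def sub (F : Fo) : List ℕ → Fo
  | [] => F
  | k :: p => (sub F p).child k

def live (F : Fo) : List ℕ → Prop
  | [] => False
  | _ :: p => sub F p ≠ empty

def le : Fo → Fo → Prop
  | empty, _ => True
  | mk _, empty => False
  | mk f, mk g => ∀ i, le (f i) (g i)

def Mono : Fo → Prop
  | empty => True
  | mk f => (∀ i, Mono (f i)) ∧ ∀ i j, i ≤ j → le (f i) (f j)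

def join : Fo → Fo → Fo
  | empty, g => g
  | mk f, empty => mk f
  | mk f, mk g => mk fun i => join (f i) (g i)

lemma sub_append_single (f : ℕ → Fo) (k : ℕ) (w : List ℕ) : sub (mk f) (w ++ [k]) = sub (f k) w := by
  induction w with
  | nil => rfl
  | cons n w ih => simp only [List.cons_append, sub, ih]

lemma live_append_single (f : ℕ → Fo) (k : ℕ) (w : List ℕ) :
    live (mk f) (w ++ [k]) ↔ w = [] ∨ live (f k) w := by
  cases w with
  | nil => simp [live, sub]
  | cons n w => simp [live, sub_append_single]

lemma sub_empty (p : List ℕ) : sub empty p = empty := by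
  induction p with
  | nil => rfl
  | cons k p ih => simp [sub, ih, child]

lemma not_live_empty (u : List ℕ) : ¬ live empty u := by
  cases u with
  | nil => simp [live]
  | cons k p => simp [live, sub_empty]

lemma live_tail {F : Fo} {k : ℕ} {p : List ℕ} (h : live F (k :: p)) (hp : p ≠ []) : live F p := by
  cases p with
  | nil => exact absurd rfl hp
  | cons n p =>
    intro h0
    apply h
    simp [sub, h0, child]

lemma live_suffix {F : Fo} {v u : List ℕ} (h : live F u) (hv : v ≠ []) (hs : v <:+ u) : live F v := by
  induction u with
  | nil => exact absurd (List.suffix_nil.1 hs) hv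
  | cons k p ih =>
    rcases List.suffix_cons_iff.1 hs with rfl | hs
    · exact h
    · refine ih (live_tail h ?_) hs
      rintro rfl
      exact hv (List.suffix_nil.1 hs)

lemma live_ne {F : Fo} {u : List ℕ} (h : live F u) : u ≠ [] := by
  rintro rfl
  exact h

lemma le_refl' (F : Fo) : le F F := by
  induction F with
  | empty => trivial
  | mk f ih => exact fun i => ih i

lemma le_trans' {F G H : Fo} (h1 : le F G) (h2 : le G H) : le F H := by
  induction F generalizing G H with
  | empty => trivial
  | mk f ih =>
    cases G with
    | empty => exact h1.elim
    | mk g =>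
      cases H with
      | empty => exact h2.elim
      | mk h => exact fun i => ih i (h1 i) (h2 i)

lemma le_child {F G : Fo} (h : le F G) (k : ℕ) : le (F.child k) (G.child k) := by
  cases F with
  | empty => trivial
  | mk f =>
    cases G with
    | empty => exact h.elim
    | mk g => exact h k

lemma le_sub {F G : Fo} (h : le F G) (p : List ℕ) : le (sub F p) (sub G p) := by
  induction p with
  | nil => exact h
  | cons k p ih => exact le_child ih k

lemma live_le {F G : Fo} (h : le F G) {u : List ℕ} (hu : live F u) : live G u := by
  cases u with
  | nil => exact hu
  | cons k p =>
    intro h0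
    apply hu
    have := le_sub h p
    rw [h0] at this
    cases hF : sub F p with
    | empty => rfl
    | mk f => rw [hF] at this; exact this.elim

lemma le_join_left (F G : Fo) : le F (join F G) := by
  induction F generalizing G with
  | empty => trivial
  | mk f ih =>
    cases G with
    | empty => exact le_refl' _
    | mk g => exact fun i => ih i (g i)

lemma le_join_right (F G : Fo) : le G (join F G) := by
  induction F generalizing G with
  | empty => exact le_refl' _
  | mk f ih =>
    cases G with
    | empty => trivial
    | mk g => exact fun i => ih i (g i)

lemma join_mono {F F' G G' : Fo} (h1 : le F F') (h2 : le G G') : le (join F G) (join F' G') := by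
  induction F generalizing F' G G' with
  | empty => exact le_trans' h2 (le_join_right _ _)
  | mk f ih =>
    cases F' with
    | empty => exact h1.elim
    | mk f' =>
      cases G with
      | empty => exact le_trans' h1 (le_join_left _ _)
      | mk g =>
        cases G' with
        | empty => exact h2.elim
        | mk g' => exact fun i => ih i (h1 i) (h2 i)

lemma Mono_join {F G : Fo} (h1 : Mono F) (h2 : Mono G) : Mono (join F G) := by
  induction F generalizing G with
  | empty => exact h2
  | mk f ih =>
    cases G with
    | empty => exact h1
    | mk g => exact ⟨fun i => ih i (h1.1 i) (h2.1 i), fun i j hij => join_mono (h1.2 i j hij) (h2.2 i j hij)⟩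

end Fo

/-- The family attached to a forest. -/
noncomputable def psiF (F : Fo) : List ℕ → List ℕ → ℝ := fun u v => ind (F.live v ∧ v <:+ u)

/-- Coherent systems of functionals. -/
def Coh {X : Type} [NormedAddCommGroup X] [NormedSpace ℝ X] (D : ℝ) (y : List ℕ → X) :
    Fo → List ℕ → StrongDual ℝ X → Prop
  | .empty, _, _ => True
  | .mk g, r, φ => ∃ (m : ℕ → ℕ) (Φ : ℕ → StrongDual ℝ X), StrictMono m ∧
      (∀ x, Tendsto (fun i => Φ i x) atTop (𝓝 (φ x))) ∧
      ∀ i, ‖Φ i‖ ≤ D ∧ Φ i (y (m i :: r)) = 1 ∧ Coh D y (g i) (m i :: r) (Φ i)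

section
variable {X : Type} [NormedAddCommGroup X] [NormedSpace ℝ X]

lemma Coh.mono {D : ℝ} {y : List ℕ → X} {F G : Fo} (hle : F.le G) {r : List ℕ} {φ : StrongDual ℝ X}
    (h : Coh D y G r φ) : Coh D y F r φ := by
  induction F generalizing G r φ with
  | empty => trivial
  | mk f ih =>
    cases G with
    | empty => exact hle.elim
    | mk g =>
      obtain ⟨m, Φ, h1, h2, h3⟩ := h
      exact ⟨m, Φ, h1, h2, fun i => ⟨(h3 i).1, (h3 i).2.1, ih i (hle i) (h3 i).2.2⟩⟩

lemma exists_coh [TopologicalSpace.SeparableSpace X] {F : Fo} {y : List ℕ → X} {c : ℝ} (hc : 0 ≤ c)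
    (hL : Lower (psiF F) y c) (G : Fo) (hG : G.Mono) (r : List ℕ)
    (hr : ∀ u, G.live u → F.live (u ++ r)) :
    ∃ φ : StrongDual ℝ X, ‖φ‖ ≤ c ∧ Coh c y G r φ ∧ ∀ v, v <:+ r → φ (y v) = ind (F.live v) := by
  induction G generalizing r with
  | empty =>
    obtain ⟨φ, h1, h2⟩ := hb_functional (psiF F r) y c hc (fun a => hL a r)
    refine ⟨φ, h1, trivial, fun v hv => ?_⟩
    rw [h2]
    exact ind_congr (by simp [hv])
  | mk f ih =>
    have : ∀ i, ∃ φ : StrongDual ℝ X, ‖φ‖ ≤ c ∧ Coh c y (f i) (i :: r) φ ∧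
        ∀ v, v <:+ i :: r → φ (y v) = ind (F.live v) := by
      intro i
      refine ih i (hG.1 i) (i :: r) fun u hu => ?_
      have := hr (u ++ [i]) ((Fo.live_append_single f i u).2 (Or.inr hu))
      simpa using this
    choose Φ hΦ1 hΦ2 hΦ3 using this
    obtain ⟨φ, hφ, m, hm, ht⟩ := weakstar_subseq Φ c hΦ1
    refine ⟨φ, hφ, ⟨m, fun i => Φ (m i), hm, ht, fun i => ⟨hΦ1 _, ?_, ?_⟩⟩, fun v hv => ?_⟩
    · rw [hΦ3 _ _ (List.suffix_refl _), ind_true]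
      exact hr [m i] ((Fo.live_append_single f (m i) []).2 (Or.inl rfl))
    · exact (hΦ2 (m i)).mono (hG.2 _ _ hm.le_apply)
    · refine tendsto_nhds_unique (ht (y v)) ?_
      have : (fun i => Φ (m i) (y v)) = fun _ => ind (F.live v) := by
        funext i
        exact hΦ3 _ _ (hv.trans (List.suffix_cons _ _))
      rw [this]
      exact tendsto_const_nhds

lemma y_dead {F : Fo} {y : List ℕ → X} {C : ℝ} (hU : Upper (psiF F) y C) {v : List ℕ}
    (hv : ¬ F.live v) : y v = 0 := by
  have := hU (Finsupp.single v 1) 0 le_rfl (by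
    intro u
    rw [lc_single, psiF, ind_false (by tauto)]
    simp)
  rw [lc_single] at this
  simpa using this

lemma weak_null {F : Fo} {y : List ℕ → X} {C : ℝ} (hU : Upper (psiF F) y C) (r : List ℕ)
    (f : StrongDual ℝ X) : Tendsto (fun n => f (y (n :: r))) atTop (𝓝 0) := by
  have key : ∀ s : Finset ℕ, ∑ n ∈ s, |f (y (n :: r))| ≤ ‖f‖ * (C * 1) := by
    intro s
    let a : List ℕ →₀ ℝ := ∑ n ∈ s, Finsupp.single (n :: r) (SignType.sign (f (y (n :: r))) : ℝ)
    have ha : ∀ {Z : Type} [AddCommGroup Z] [Module ℝ Z] (w : List ℕ → Z),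
        lc w a = ∑ n ∈ s, (SignType.sign (f (y (n :: r))) : ℝ) • w (n :: r) := by
      intro Z _ _ w
      simp [a, lc, map_sum]
    have h1 : ‖lc y a‖ ≤ C * 1 := by
      apply hU a 1 zero_le_one
      intro u
      rw [ha]
      by_cases hex : ∃ n ∈ s, F.live (n :: r) ∧ n :: r <:+ u
      · obtain ⟨n, hn, hn'⟩ := hex
        rw [Finset.sum_eq_single_of_mem n hn]
        · rw [psiF, ind_true hn']
          rcases lt_trichotomy (f (y (n :: r))) 0 with h | h | h
          · simp [sign_neg h]
          · simp [h]
          · simp [sign_pos h]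
        · intro n' _ hne
          rw [psiF, ind_false, smul_zero]
          rintro ⟨_, h⟩
          have := List.suffix_of_suffix_length_le h hn'.2 (by simp)
          have := this.eq_of_length_le (by simp)
          simp at this
          exact hne this
      · rw [Finset.sum_eq_zero]
        · simp
        · intro n hn
          rw [psiF, ind_false, smul_zero]
          exact fun h => hex ⟨n, hn, h⟩
    have h2 : ∑ n ∈ s, |f (y (n :: r))| = f (lc y a) := by
      rw [ha, map_sum]
      apply Finset.sum_congr rfl
      intro n _
      rw [map_smul, smul_eq_mul, sign_mul_self]
    rw [h2]
    refine (le_abs_self _).trans ((f.le_opNorm _).trans ?_)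
    gcongr
  have hs : Summable fun n => |f (y (n :: r))| :=
    summable_of_sum_le (fun n => abs_nonneg _) key
  exact tendsto_zero_iff_abs_tendsto_zero _ |>.2 hs.tendsto_atTop_zero

end

end ElU

namespace ElU

open Filter Topology

section
variable {X : Type} [NormedAddCommGroup X] [NormedSpace ℝ X]

/-- From branch estimates to single-node upper estimates. -/
lemma upper_of_UU {I J : Type} {ψ : ℕ → J → I → ℝ} {y : List ℕ × I → X} {C : ℝ} {ρ : List ℕ}
    (h : UU ψ Set.univ (fun σ => σ = ρ) C y) : Upper (ψ ρ.length) (fun i => y (ρ, i)) C := by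
  intro a R hR hj
  have := h ρ rfl (a.mapDomain (fun i => (ρ, i))) trivial (by
    intro r hr
    obtain ⟨i, rfl, hi⟩ := mapDomain_ne hr
    exact ⟨rfl, List.suffix_refl _⟩) R hR (by
    rintro ⟨ρ', j⟩
    by_cases hρ : ρ' = ρ
    · subst hρ
      rw [lc_Psi_mapDomain]
      exact hj j
    · rw [lc_mapDomain]
      have : (fun i => Psi ψ (ρ', j) (ρ, i)) = fun _ => 0 := by
        funext i
        simp [Psi, ind_false (fun h : ρ = ρ' => hρ h.symm)]
      rw [this, lc_const_zero, abs_zero]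
      exact hR)
  rwa [lc_mapDomain] at this

structure FState (D : ℝ) (y : List ℕ × List ℕ → X) where
  ρ : List ℕ
  r : List ℕ
  G : Fo
  φ : StrongDual ℝ X
  alive : Bool
  hφ : ‖φ‖ ≤ D
  hcoh : Coh D (fun v => y (ρ, v)) G r φ
  h1 : alive = true → φ (y (ρ, r)) = 1
  hmono : G.Mono

noncomputable def FState.vec {D : ℝ} {y : List ℕ × List ℕ → X} (s : FState D y) : X :=
  bif s.alive then y (s.ρ, s.r) else 0

def FState.kill {D : ℝ} {y : List ℕ × List ℕ → X} (s : FState D y) : FState D y :=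
  { s with alive := false, h1 := by simp }

def FOpt {D : ℝ} {y : List ℕ × List ℕ → X} (s : FState D y) (k : ℕ) (s' : FState D y) : Prop :=
  s'.ρ = s.ρ ∧ s'.G = s.G.child k ∧
    ((s.G = .empty ∧ s'.alive = false) ∨ (s.G ≠ .empty ∧ s'.alive = true ∧ ∃ m, s'.r = m :: s.r))

lemma forest_thin [TopologicalSpace.SeparableSpace X] (F : ℕ → Fo) (hF : ∀ n, (F n).Mono)
    (y : List ℕ × List ℕ → X) (c C : ℝ) (hc : 0 ≤ c)
    (hL : ∀ ρ : List ℕ, Lower (psiF (F ρ.length)) (fun i => y (ρ, i)) c)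
    (hU : ∀ ρ : List ℕ, Upper (psiF (F ρ.length)) (fun i => y (ρ, i)) C) :
    ∃ t : List ℕ → List ℕ → List ℕ,
      (∀ ρ k p, (F ρ.length).live (k :: p) → ∃ m, t ρ (k :: p) = m :: t ρ p) ∧
      (∀ ρ, t ρ [] = []) ∧
      (∀ ρ u, (F ρ.length).live u → (F ρ.length).live (t ρ u)) ∧
      ∃ z : List ℕ × List ℕ → X,
        (∀ ρ u, (F ρ.length).live u → z (ρ, u) = y (ρ, t ρ u)) ∧
        (∀ ρ u, ¬ (F ρ.length).live u → z (ρ, u) = 0) ∧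
        Lower (Psi fun n => psiF (F n)) z (4 * c) := by
  have hinit : ∀ ρ : List ℕ, ∃ s : FState c y, s.ρ = ρ ∧ s.r = [] ∧ s.G = F ρ.length ∧ s.alive = false := by
    intro ρ
    obtain ⟨φ, h1, h2, -⟩ := exists_coh hc (hL ρ) (F ρ.length) (hF _) [] (by simp)
    exact ⟨⟨ρ, [], F ρ.length, φ, false, h1, h2, by simp, hF _⟩, rfl, rfl, rfl, rfl⟩
  choose s0 hs1 hs2 hs3 hs4 using hinit
  obtain ⟨st, h0, hO, hfin⟩ := fusion (St := FState c y) (fun s => s.vec) (fun s => s.φ) c (fun s => s.hφ)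
    FOpt (by
    intro s k
    rcases hG : s.G with _ | g
    · refine ⟨fun _ => s.kill, fun _ => ⟨rfl, ?_, Or.inl ⟨hG, rfl⟩⟩, fun s' => ?_, fun s' => ?_⟩
      · change s.G = _
        rw [hG]; rfl
      · simp [FState.vec, FState.kill]
      · exact tendsto_const_nhds
    · have hcoh := s.hcoh
      rw [hG] at hcoh
      obtain ⟨m, Φ, hm, ht, hi⟩ := hcoh
      have hmono := s.hmono
      rw [hG] at hmono
      have hle : ∀ j, (g k).le (g (k + j)) := fun j => hmono.2 _ _ (Nat.le_add_right k j)
      refine ⟨fun j => ⟨s.ρ, m (k + j) :: s.r, g k, Φ (k + j), true, (hi _).1,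
        (hi _).2.2.mono (hle j), fun _ => (hi _).2.1, hmono.1 k⟩,
        fun j => ⟨rfl, ?_, Or.inr ⟨by simp [hG], rfl, _, rfl⟩⟩, fun s' => ?_, fun s' => ?_⟩
      · change g k = _
        rw [hG]; rfl
      · have h := (weak_null (hU s.ρ) s.r s'.φ).comp hm.tendsto_atTop
        have h2 := h.comp (tendsto_add_atTop_nat k)
        refine h2.congr fun j => ?_
        simp [FState.vec, add_comm]
      · have h2 := (ht s'.vec).comp (tendsto_add_atTop_nat k)
        refine h2.congr fun j => ?_
        simp [add_comm]) s0
  have hρ : ∀ ρ u, (st (ρ, u)).ρ = ρ ∧ (st (ρ, u)).G = (F ρ.length).sub u := by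
    intro ρ u
    induction u with
    | nil => rw [h0]; exact ⟨hs1 ρ, hs3 ρ⟩
    | cons k p ih =>
      obtain ⟨e1, e2, -⟩ := hO ρ k p
      rw [e1, e2, ih.1, ih.2]
      exact ⟨rfl, rfl⟩
  have hal : ∀ ρ u, (st (ρ, u)).alive = true ↔ (F ρ.length).live u := by
    intro ρ u
    cases u with
    | nil => rw [h0, hs4]; simp [Fo.live]
    | cons k p =>
      obtain ⟨-, -, h⟩ := hO ρ k p
      rw [(hρ ρ p).2] at h
      rcases h with h | h
      · simp [Fo.live, h.1, h.2]
      · simp [Fo.live, h.1, h.2]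
  have hz1 : ∀ ρ u, (F ρ.length).live u → (st (ρ, u)).vec = y (ρ, (st (ρ, u)).r) := by
    intro ρ u hu
    rw [FState.vec, (hal ρ u).2 hu, (hρ ρ u).1]
    rfl
  refine ⟨fun ρ u => (st (ρ, u)).r, ?_, ?_, ?_, fun v => (st v).vec, hz1, ?_, ?_⟩
  · intro ρ k p h
    obtain ⟨-, -, h'⟩ := hO ρ k p
    rw [(hρ ρ p).2] at h'
    rcases h' with h' | h'
    · exact absurd h'.1 h
    · exact h'.2.2
  · intro ρ
    simp only [h0, hs2]
  · intro ρ u hu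
    by_contra hcon
    have := (st (ρ, u)).h1 ((hal ρ u).2 hu)
    rw [(hρ ρ u).1] at this
    have h3 := y_dead (hU ρ) hcon
    simp only at h3
    rw [h3, map_zero] at this
    exact zero_ne_one this
  · intro ρ u hu
    have : (st (ρ, u)).alive = false := by
      rw [← Bool.not_eq_true, hal]
      exact hu
    simp [FState.vec, this]
  · rintro a ⟨ρ, u⟩
    have h := hfin (fun v => (F v.1.length).live v.2) (by simp [Fo.live]) (by
      rintro ⟨ρ, u⟩ hv
      rw [hz1 ρ u hv]
      have := (st (ρ, u)).h1 ((hal ρ u).2 hv)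
      rwa [(hρ ρ u).1] at this) (by
      rintro ⟨ρ, u⟩ hv
      have : (st (ρ, u)).alive = false := by
        rw [← Bool.not_eq_true, hal]
        exact hv
      simp [FState.vec, this]) a ρ u
    convert h using 3
    funext v
    by_cases hv : v.1 = ρ
    · simp only [Psi, psiF, hv, ind_true, one_mul, true_and]
      exact ind_congr and_comm
    · simp [Psi, hv, ind_false]

/-- The upper estimate survives thinning. -/
lemma forest_upper (F : ℕ → Fo) (y z : List ℕ × List ℕ → X) (t : List ℕ → List ℕ → List ℕ) (c' : ℝ)
    (ht : ∀ ρ k p, (F ρ.length).live (k :: p) → ∃ m, t ρ (k :: p) = m :: t ρ p)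
    (ht0 : ∀ ρ, t ρ [] = [])
    (htl : ∀ ρ u, (F ρ.length).live u → (F ρ.length).live (t ρ u))
    (hz1 : ∀ ρ u, (F ρ.length).live u → z (ρ, u) = y (ρ, t ρ u))
    (hz0 : ∀ ρ u, ¬ (F ρ.length).live u → z (ρ, u) = 0)
    (hL : Lower (Psi fun n => psiF (F n)) z c') (S : List ℕ → Prop) (C : ℝ)
    (hU : UU (fun n => psiF (F n)) Set.univ S C y) : UU (fun n => psiF (F n)) Set.univ S C z := by
  classical
  have hlen : ∀ ρ u, (F ρ.length).live u → (t ρ u).length = u.length := by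
    intro ρ u
    induction u with
    | nil => simp [Fo.live]
    | cons k p ih =>
      intro h
      obtain ⟨m, hm⟩ := ht ρ k p h
      rw [hm]
      by_cases hp : p = []
      · subst hp; simp [ht0]
      · simp [ih (Fo.live_tail h hp)]
  have hsuf : ∀ ρ u v, (F ρ.length).live u → v <:+ u → t ρ v <:+ t ρ u := by
    intro ρ u v
    induction u with
    | nil => simp [Fo.live]
    | cons k p ih =>
      intro h hv
      rcases List.suffix_cons_iff.1 hv with rfl | hv
      · exact List.suffix_refl _
      · obtain ⟨m, hm⟩ := ht ρ k p h
        rw [hm]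
        by_cases hp : p = []
        · subst hp
          rw [List.suffix_nil.1 hv]
          exact List.suffix_cons _ _
        · exact (ih (Fo.live_tail h hp) hv).trans (List.suffix_cons _ _)
  have hinj : ∀ ρ u v, (F ρ.length).live u → (F ρ.length).live v → t ρ u = t ρ v → u = v := by
    intro ρ u v hu hv he
    by_contra hne
    have h := hL (Finsupp.single (ρ, u) 1 - Finsupp.single (ρ, v) 1) (ρ, u)
    rw [lc_sub, lc_sub, lc_single, lc_single, lc_single, lc_single, hz1 _ _ hu, hz1 _ _ hv, he] at h
    have hns : ¬ v <:+ u := by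
      intro h'
      have := h'.eq_of_length (by rw [← hlen ρ u hu, ← hlen ρ v hv, he])
      exact hne this.symm
    simp only [Psi, psiF, ind_true] at h
    rw [ind_true ⟨hu, List.suffix_refl u⟩, ind_false (fun h' => hns h'.2)] at h
    simp at h
    norm_num at h
  -- the pull-back of functionals
  have hpull : ∀ ρ u, (∀ w, (F ρ.length).live w → ¬ t ρ w <:+ u) ∨
      ∃ w0, ∀ w, (F ρ.length).live w → (t ρ w <:+ u ↔ w <:+ w0) := by
    intro ρ u
    by_cases hex : ∃ w, (F ρ.length).live w ∧ t ρ w <:+ u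
    · right
      let P : ℕ → Prop := fun n => ∃ w, (F ρ.length).live w ∧ t ρ w <:+ u ∧ w.length = n
      have hP : P (Nat.findGreatest P u.length) := by
        obtain ⟨w, h1, h2⟩ := hex
        apply Nat.findGreatest_spec (m := w.length)
        · rw [← hlen ρ w h1]
          exact h2.length_le
        · exact ⟨w, h1, h2, rfl⟩
      obtain ⟨w0, h1, h2, h3⟩ := hP
      refine ⟨w0, fun w hw => ⟨fun h => ?_, fun h => (hsuf ρ w0 w h1 h).trans h2⟩⟩
      have hl : w.length ≤ w0.length := by
        rw [h3]
        apply Nat.le_findGreatest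
        · rw [← hlen ρ w hw]
          exact h.length_le
        · exact ⟨w, hw, h, rfl⟩
      have hne : suf w0 w.length ≠ [] := by
        intro h'
        have h4 := congrArg List.length h'
        rw [suf_length hl] at h4
        exact Fo.live_ne hw (List.length_eq_zero_iff.1 h4)
      have hlv := Fo.live_suffix h1 hne (suf_suffix w0 w.length)
      have h5 := (hsuf ρ w0 _ h1 (suf_suffix w0 w.length)).trans h2
      have h6 := List.suffix_of_suffix_length_le h h5 (by
        rw [hlen _ _ hw, hlen _ _ hlv, suf_length hl])
      have h7 := h6.eq_of_length (by rw [hlen _ _ hw, hlen _ _ hlv, suf_length hl])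
      rw [hinj ρ _ _ hw hlv h7]
      exact suf_suffix _ _
    · left
      intro w hw h
      exact hex ⟨w, hw, h⟩
  intro τ hτ a _ hs R hR hq
  let b : List ℕ × List ℕ →₀ ℝ := a.filter (fun r => (F r.1.length).live r.2)
  have hb : ∀ r, b r ≠ 0 → (F r.1.length).live r.2 ∧ a r ≠ 0 := by
    intro r hr
    by_cases hP : (F r.1.length).live r.2
    · simp only [b, Finsupp.filter_apply, hP, if_true] at hr
      exact ⟨hP, hr⟩
    · simp [b, Finsupp.filter_apply, hP] at hr
  have hfilter : ∀ {Z : Type} [AddCommGroup Z] [Module ℝ Z] (w : List ℕ × List ℕ → Z),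
      (∀ ρ u, ¬ (F ρ.length).live u → w (ρ, u) = 0) → lc w a = lc w b := by
    intro Z _ _ w hw
    have h1 : a = b + a.filter (fun r => ¬ (F r.1.length).live r.2) := (Finsupp.filter_add_filter_not _ _).symm
    conv_lhs => rw [h1]
    rw [lc_add, add_eq_left]
    have h2 : lc w (a.filter (fun r => ¬ (F r.1.length).live r.2)) =
        lc (fun _ => (0 : Z)) (a.filter (fun r => ¬ (F r.1.length).live r.2)) := by
      apply lc_congr
      intro r hr
      apply hw
      intro h
      simp [Finsupp.filter_apply, h] at hr
    rw [h2, lc_const_zero]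
  let g : List ℕ × List ℕ → List ℕ × List ℕ := fun r => (r.1, t r.1 r.2)
  have e1 : lc z a = lc y (b.mapDomain g) := by
    rw [hfilter z hz0, lc_mapDomain]
    exact lc_congr fun r hr => hz1 r.1 r.2 (hb r hr).1
  rw [e1]
  apply hU τ hτ _ trivial _ R hR
  · rintro ⟨ρ, u⟩
    rw [lc_mapDomain]
    rcases hpull ρ u with h | ⟨w0, hw0⟩
    · have : lc (fun i => Psi (fun n => psiF (F n)) (ρ, u) (g i)) b = lc (fun _ => (0 : ℝ)) b := by
        apply lc_congr
        rintro ⟨ρ', w⟩ hr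
        have hlv := (hb _ hr).1
        simp only [Psi, g, psiF]
        by_cases hρ : ρ' = ρ
        · subst hρ
          rw [ind_false (p := _ ∧ _) (fun h' => h w hlv h'.2), mul_zero]
        · rw [ind_false hρ, zero_mul]
      rw [this, lc_const_zero, abs_zero]
      exact hR
    · have : lc (fun i => Psi (fun n => psiF (F n)) (ρ, u) (g i)) b =
          lc (Psi (fun n => psiF (F n)) (ρ, w0)) b := by
        apply lc_congr
        rintro ⟨ρ', w⟩ hr
        have hlv := (hb _ hr).1
        simp only [Psi, g, psiF]
        by_cases hρ : ρ' = ρ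
        · subst hρ
          congr 1
          apply ind_congr
          simp only at hlv
          simp [hlv, htl ρ' w hlv, hw0 w hlv]
        · rw [ind_false hρ, zero_mul, zero_mul]
      rw [this, ← hfilter]
      · exact hq _
      · intro ρ' v hv
        simp only [Psi, psiF]
        by_cases hρ : ρ' = ρ
        · subst hρ
          rw [ind_false (p := _ ∧ _) (fun h' => hv h'.1), mul_zero]
        · rw [ind_false hρ, zero_mul]
  · intro r hr
    obtain ⟨i, rfl, hi⟩ := mapDomain_ne hr
    exact hs i (hb i hi).2

end

end ElU

namespace ElU

open Filter Topology

section
variable {X : Type} [NormedAddCommGroup X] [NormedSpace ℝ X]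

lemma good_equiv {I I' J : Type} (e : I' ≃ I) (φ : J → I → ℝ) (C : ℝ)
    (h : Good X (fun j m => φ j (e m)) C) : Good X φ C := by
  obtain ⟨x, h1, h2⟩ := h
  have e1 : ∀ a : I →₀ ℝ, lc (fun i => x (e.symm i)) a = lc x (a.mapDomain e.symm) := fun a => by
    rw [lc_mapDomain]
  have e2 : ∀ (a : I →₀ ℝ) j, lc (φ j) a = lc (fun m => φ j (e m)) (a.mapDomain e.symm) := fun a j => by
    rw [lc_mapDomain]
    simp
  refine ⟨fun i => x (e.symm i), fun a j => ?_, fun a R hR hj => ?_⟩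
  · rw [e1, e2]
    exact h1 _ _
  · rw [e1]
    exact h2 _ R hR fun j => by rw [← e2]; exact hj j

/-- The block family. -/
noncomputable def blk (F : ℕ → Fo) : ℕ × List ℕ → ℕ × List ℕ → ℝ :=
  fun q r => ind (r.1 = q.1) * psiF (F q.1) q.2 r.2

def enumE : ℕ ≃ ℕ × List ℕ :=
  Nat.pairEquiv.symm.trans (Equiv.prodCongr (Equiv.refl ℕ) (Denumerable.eqv (List ℕ)).symm)

lemma enumE_le (m : ℕ) : (enumE m).1 ≤ m := Nat.unpair_left_le m

lemma abs_psiF_le (F : Fo) (u v : List ℕ) : |psiF F u v| ≤ 1 := abs_ind_le _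

lemma suf_suf {τ : List ℕ} {k m : ℕ} (hk : k ≤ m) (hm : m ≤ τ.length) : suf (suf τ m) k = suf τ k := by
  simp only [suf, List.drop_drop, List.length_drop]
  congr 1
  omega

lemma blk_coord (F : ℕ → Fo) (k j : ℕ) (p : List ℕ) (hl : (F k).live (j :: p)) (r : ℕ × List ℕ) :
    blk F (k, j :: p) r - blk F (k, p) r = ind (r = (k, j :: p)) := by
  obtain ⟨k', v⟩ := r
  by_cases hk : k' = k
  · subst hk
    simp only [blk, ind_true, one_mul, psiF]
    by_cases hv : v = j :: p
    · subst hv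
      rw [ind_true ⟨hl, List.suffix_refl _⟩, ind_true rfl, ind_false, sub_zero]
      rintro ⟨-, h⟩
      have := h.length_le
      simp at this
    · rw [ind_false (p := (k', v) = (k', j :: p)) (by simpa using hv), sub_eq_zero]
      apply ind_congr
      rw [List.suffix_cons_iff]
      tauto
  · rw [ind_false (p := (k', v) = (k, j :: p)) (by simp [hk])]
    simp [blk, ind_false hk]

/-- Stage 2: gluing countably many forests. -/
lemma good_blk [CompleteSpace X] [TopologicalSpace.SeparableSpace X] {K : ℝ}
    (hK : IsKElastic X K) (hK1 : 1 ≤ K) (F : ℕ → Fo) (hF : ∀ n, (F n).Mono)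
    (hG : ∀ n, Good X (psiF (F n)) K) : Good X (blk F) K := by
  classical
  apply good_equiv enumE
  have hbd : ∀ q r, |blk F q r| ≤ 1 := by
    intro q r
    rw [blk, abs_mul]
    have h1 := abs_ind_le (r.1 = q.1)
    have h2 := abs_psiF_le (F q.1) q.2 r.2
    calc _ ≤ (1 : ℝ) * 1 := by gcongr
      _ = 1 := one_mul 1
  choose w hwL hwU using hG
  have htree : ∀ T : List ℕ → Prop, T [] → (∀ n τ, T (n :: τ) → T τ) → WellFounded (ExtRel T) →
      ∃ x : List ℕ × List ℕ → X, Lower (Psi fun n => psiF (F n)) x 1 ∧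
        UU (fun n => psiF (F n)) Set.univ T K x := by
    intro T hT0 hTs hW
    apply tree_induction hK hK1 (fun n => psiF (F n)) (fun n i => ⟨1, fun j => abs_psiF_le _ _ _⟩) Set.univ
      (fun _ _ _ => trivial) (fun r => w r.1.length r.2) 1 K (by linarith) (fun ρ => hwL _) _ _ T hT0 hTs hW
    · intro ρ τ hτ a _ hs R hR hq
      have ha : a = (a.mapDomain Prod.snd).mapDomain (fun i => (ρ, i)) := by
        rw [← Finsupp.mapDomain_comp]
        conv_lhs => rw [← Finsupp.mapDomain_id (v := a)]
        apply Finsupp.mapDomain_congr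
        intro r hr
        have := (hs r (Finsupp.mem_support_iff.1 hr)).1
        simp only at this
        simp [← this]
      rw [ha, lc_mapDomain]
      apply hwU ρ.length _ R hR
      intro j
      have := hq (ρ, j)
      rw [ha, lc_Psi_mapDomain] at this
      exact this
    · intro y c C hc hC hyL hyU
      obtain ⟨t, ht, ht0, htl, z, hz1, hz0, hzL⟩ := forest_thin F hF y c C hc hyL (fun ρ => upper_of_UU (hyU ρ))
      exact ⟨z, 4 * c, hzL, fun S C' hC' h => (forest_upper F y z t _ ht ht0 htl hz1 hz0 hzL S C' h).mono
        (by linarith)⟩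
  have hmain := principle (X := X) K (fun q m => blk F q (enumE m))
    (fun m => (F (enumE m).1).live (enumE m).2) (by
    intro m hm
    refine ⟨2, fun a R hR h => ?_⟩
    obtain ⟨k, v, hkv⟩ : ∃ k v, enumE m = (k, v) := ⟨_, _, rfl⟩
    rw [hkv] at hm
    rcases v with _ | ⟨j, p⟩
    · exact hm.elim
    · have h1 := h (k, j :: p)
      have h2 := h (k, p)
      have : a m = lc (fun i => blk F (k, j :: p) (enumE i)) a - lc (fun i => blk F (k, p) (enumE i)) a := by
        rw [← lc_fun_sub, ← lc_ind_eq a m]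
        apply lc_congr
        intro i _
        rw [blk_coord F k j p hm]
        apply ind_congr
        rw [← hkv]
        exact enumE.injective.eq_iff.symm
      rw [this]
      refine (abs_sub _ _).trans ?_
      linarith) (by
    intro T hT0 hTs hW
    obtain ⟨x, hxL, hxU⟩ := htree T hT0 hTs hW
    have hTsuf : ∀ ρ τ : List ℕ, ρ <:+ τ → T τ → T ρ := by
      intro ρ τ h
      induction τ with
      | nil => intro hτ; rwa [List.suffix_nil.1 h]
      | cons n τ ih =>
        intro hτ
        rcases List.suffix_cons_iff.1 h with h | h
        · rwa [h]
        · exact ih h (hTs _ _ hτ)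
    have hdead : ∀ ρ v, T ρ → ¬ (F ρ.length).live v → x (ρ, v) = 0 := by
      intro ρ v hρ hv
      have hUρ : UU (fun n => psiF (F n)) Set.univ (fun σ => σ = ρ) K x :=
        hxU.sub (fun σ hσ => by rw [hσ]; exact hρ) (fun _ _ _ => rfl)
      exact y_dead (upper_of_UU hUρ) hv
    refine ⟨fun τ => if (F (enumE τ.length).1).live (enumE τ.length).2 then
      x (suf τ (enumE τ.length).1, (enumE τ.length).2) else 0, fun τ h => if_neg h, fun τ hτ a ha => ?_⟩
    have hle : ∀ m, a m ≠ 0 → m ≤ τ.length := fun m hm => by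
      by_contra h
      exact hm (ha m (by omega))
    let g : ℕ → List ℕ × List ℕ := fun m => (suf τ (enumE m).1, (enumE m).2)
    have e1 : lc (fun m => if (F (enumE (suf τ m).length).1).live (enumE (suf τ m).length).2 then
      x (suf (suf τ m) (enumE (suf τ m).length).1, (enumE (suf τ m).length).2) else 0) a =
        lc x (a.mapDomain g) := by
      rw [lc_mapDomain]
      apply lc_congr
      intro m hm
      rw [suf_length (hle m hm), suf_suf (enumE_le m) (hle m hm)]
      split_ifs with h
      · rfl
      · symm
        apply hdead _ _ (hTsuf _ _ (suf_suffix _ _) hτ)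
        rwa [suf_length ((enumE_le m).trans (hle m hm))]
    simp only at e1 ⊢
    rw [e1]
    have e2 : ∀ k u, k ≤ τ.length → lc (Psi (fun n => psiF (F n)) (suf τ k, u)) (a.mapDomain g) =
        lc (fun m => blk F (k, u) (enumE m)) a := by
      intro k u hk
      rw [lc_mapDomain]
      apply lc_congr
      intro m hm
      have hm' := (enumE_le m).trans (hle m hm)
      simp only [Psi, blk, g, suf_length hk]
      congr 1
      apply ind_congr
      constructor
      · intro h
        have := congrArg List.length h
        rwa [suf_length hk, suf_length hm'] at this
      · intro h
        rw [h]
    constructor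
    · rintro ⟨k, u⟩
      by_cases hk : k ≤ τ.length
      · rw [← e2 k u hk]
        have := hxL (a.mapDomain g) (suf τ k, u)
        rwa [one_mul] at this
      · have : lc (fun m => blk F (k, u) (enumE m)) a = lc (fun _ => (0 : ℝ)) a := by
          apply lc_congr
          intro m hm
          have hm' := (enumE_le m).trans (hle m hm)
          simp only [blk]
          rw [ind_false (by omega), zero_mul]
        rw [this, lc_const_zero, abs_zero]
        positivity
    · intro R hR hj
      apply hxU τ hτ _ trivial _ R hR
      · rintro ⟨ρ, u⟩
        by_cases hρ : ρ <:+ τ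
        · rw [← suf_eq_of_suffix hρ, e2 _ _ hρ.length_le]
          exact hj _
        · rw [lc_mapDomain]
          have : lc (fun m => Psi (fun n => psiF (F n)) (ρ, u) (g m)) a = lc (fun _ => (0 : ℝ)) a := by
            apply lc_congr
            intro m _
            simp only [Psi, g]
            rw [ind_false, zero_mul]
            intro h
            apply hρ
            rw [← h]
            exact suf_suffix _ _
          rw [this, lc_const_zero, abs_zero]
          exact hR
      · intro r hr
        obtain ⟨m, rfl, hm⟩ := mapDomain_ne hr
        exact ⟨hTsuf _ _ (suf_suffix _ _) hτ, suf_suffix _ _⟩)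
  obtain ⟨x, hxL, hxU⟩ := hmain
  exact elastic_good hK hK1 _ (fun i => ⟨1, fun j => hbd _ _⟩) x 2 (K + 1) hxL hxU

end

end ElU

namespace ElU

open Filter Topology

section
variable {X : Type} [NormedAddCommGroup X] [NormedSpace ℝ X]

lemma lc_comp {I I' Z : Type} [AddCommGroup Z] [Module ℝ Z] (c : I → I' →₀ ℝ) (x : I' → Z) (a : I →₀ ℝ) :
    lc x (lc c a) = lc (fun i => lc x (c i)) a := by
  simp only [lc]
  rw [← LinearMap.comp_apply]
  congr 1
  ext i
  simp

lemma good_transfer [CompleteSpace X] {I I' J J' : Type} {K : ℝ}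
    (hK : IsKElastic X K) (hK1 : 1 ≤ K) (φ : J' → I' → ℝ) (ψ : J → I → ℝ) (hG : Good X φ K)
    (hb : ∀ i, ∃ B, ∀ j, |ψ j i| ≤ B) (c : I → I' →₀ ℝ) (N N' : ℝ) (hN : 0 ≤ N) (hN' : 0 ≤ N')
    (hLow : ∀ a j M, 0 ≤ M → (∀ j', |lc (fun i => lc (φ j') (c i)) a| ≤ M) → |lc (ψ j) a| ≤ N * M)
    (hUp : ∀ a R, 0 ≤ R → (∀ j, |lc (ψ j) a| ≤ R) → ∀ j', |lc (fun i => lc (φ j') (c i)) a| ≤ N' * R) :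
    Good X ψ K := by
  obtain ⟨x, h1, h2⟩ := hG
  refine elastic_good hK hK1 ψ hb (fun i => lc x (c i)) N (K * N') ?_ ?_
  · intro a j
    apply hLow a j _ (norm_nonneg _)
    intro j'
    rw [← lc_comp, ← lc_comp, ← one_mul ‖_‖]
    exact h1 _ _
  · intro a R hR hj
    rw [← lc_comp, mul_assoc]
    apply h2 _ _ (by positivity)
    intro j'
    rw [lc_comp]
    exact hUp a R hR hj j'

lemma nil_or_snoc (u : List ℕ) : u = [] ∨ ∃ w k, u = w ++ [k] := by
  rcases List.eq_nil_or_concat u with h | ⟨w, k, h⟩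
  · exact Or.inl h
  · exact Or.inr ⟨w, k, by simpa using h⟩

lemma psiF_dead {F : Fo} {v : List ℕ} (h : ¬ F.live v) (u : List ℕ) : psiF F u v = 0 :=
  ind_false fun h' => h h'.1

lemma suffix_append_single {w u : List ℕ} {k k' : ℕ} : w ++ [k] <:+ u ++ [k'] ↔ w <:+ u ∧ k = k' := by
  rw [← List.reverse_prefix, ← List.reverse_prefix (l₁ := w)]
  simp [List.cons_prefix_cons, and_comm]

noncomputable def c0map (v : List ℕ) : ℕ →₀ ℝ :=
  match v with
  | [k] => Finsupp.single k 1
  | _ => 0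

lemma lc_c0map (k : ℕ) (v : List ℕ) : lc (delta k) (c0map v) = ind (v = [k]) := by
  rcases v with _ | ⟨n, _ | ⟨n', p⟩⟩
  · simp [c0map, lc_zero, ind_false]
  · simp only [c0map, lc_single, delta, one_smul]
    exact ind_congr (by simp)
  · simp [c0map, lc_zero, ind_false]

lemma good_F0 [CompleteSpace X] {K : ℝ} (hK : IsKElastic X K) (hK1 : 1 ≤ K) (hd : Good X delta K) :
    Good X (psiF (.mk fun _ => .empty)) K := by
  have hl : ∀ v, (Fo.mk fun _ => .empty).live v ↔ ∃ k, v = [k] := by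
    intro v
    rcases nil_or_snoc v with rfl | ⟨w, k, rfl⟩
    · simp [Fo.live]
    · rw [Fo.live_append_single]
      simp only [Fo.not_live_empty, or_false]
      constructor
      · rintro rfl; exact ⟨k, rfl⟩
      · rintro ⟨k', h⟩
        have := congrArg List.length h
        simpa using this
  have hpsi : ∀ u k v, psiF (.mk fun _ => .empty) (u ++ [k]) v = ind (v = [k]) := by
    intro u k v
    apply ind_congr
    rw [hl]
    constructor
    · rintro ⟨⟨k', rfl⟩, h⟩
      have := (suffix_append_single (w := []) (k := k')).1 h
      rw [this.2]
    · rintro rfl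
      exact ⟨⟨k, rfl⟩, List.suffix_append _ _⟩
  refine good_transfer hK hK1 delta _ hd (fun i => ⟨1, fun j => abs_psiF_le _ _ _⟩) c0map 1 1
    zero_le_one zero_le_one ?_ ?_
  · intro a u M hM h
    rw [one_mul]
    rcases nil_or_snoc u with rfl | ⟨w, k, rfl⟩
    · have : lc (psiF (.mk fun _ => .empty) []) a = lc (fun _ => (0 : ℝ)) a := by
        apply lc_congr
        intro v _
        apply ind_false
        rintro ⟨h1, h2⟩
        exact Fo.live_ne h1 (List.suffix_nil.1 h2)
      rw [this, lc_const_zero, abs_zero]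
      exact hM
    · have := h k
      simp only [lc_c0map] at this
      convert this using 3
      funext v
      exact hpsi w k v
  · intro a R hR h k
    rw [one_mul]
    have := h [k]
    simp only [lc_c0map]
    convert this using 3
    funext v
    exact (hpsi [] k v).symm

noncomputable def c1map (v : List ℕ) : ℕ × List ℕ →₀ ℝ :=
  match v.reverse with
  | [] => 0
  | [k] => Finsupp.single (0, [k]) 1
  | k :: w => Finsupp.single (k + 1, w.reverse) 1

lemma c1map_nil : c1map [] = 0 := rfl

lemma c1map_single (k : ℕ) : c1map [k] = Finsupp.single (0, [k]) 1 := rfl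

lemma c1map_append {w : List ℕ} (hw : w ≠ []) (k : ℕ) : c1map (w ++ [k]) = Finsupp.single (k + 1, w) 1 := by
  rcases nil_or_snoc w with rfl | ⟨w', k', rfl⟩
  · exact absurd rfl hw
  · simp [c1map]

def Fseq (f : ℕ → Fo) : ℕ → Fo
  | 0 => .mk fun _ => .empty
  | k + 1 => f k

lemma blk_c1_zero (f : ℕ → Fo) (u : List ℕ) (k : ℕ) (v : List ℕ) :
    lc (blk (Fseq f) (0, u ++ [k])) (c1map v) = psiF (.mk f) [k] v := by
  rcases nil_or_snoc v with rfl | ⟨w, n, rfl⟩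
  · rw [c1map_nil, lc_zero, psiF_dead (by simp [Fo.live])]
  · by_cases hw : w = []
    · subst hw
      simp only [List.nil_append, c1map_single, lc_single, blk, one_smul, ind_true, one_mul, Fseq, psiF]
      apply ind_congr
      have h1 := suffix_append_single (w := []) (u := u) (k := n) (k' := k)
      have h2 := suffix_append_single (w := []) (u := []) (k := n) (k' := k)
      simp only [List.nil_append] at h1 h2
      rw [h1, h2]
      simp [Fo.live, Fo.sub]
    · rw [c1map_append hw, lc_single, blk, ind_false (by simp), zero_mul, smul_zero, psiF, ind_false]
      rintro ⟨-, h⟩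
      have := (suffix_append_single (u := [])).1 h
      exact hw (List.suffix_nil.1 this.1)

lemma blk_c1_zero_nil (f : ℕ → Fo) (v : List ℕ) :
    lc (blk (Fseq f) (0, [])) (c1map v) = 0 := by
  rcases nil_or_snoc v with rfl | ⟨w, n, rfl⟩
  · rw [c1map_nil, lc_zero]
  · by_cases hw : w = []
    · subst hw
      simp only [List.nil_append, c1map_single, lc_single, blk, one_smul, ind_true, one_mul, Fseq, psiF]
      apply ind_false
      simp
    · rw [c1map_append hw, lc_single, blk, ind_false (by simp), zero_mul, smul_zero]

lemma blk_c1_succ (f : ℕ → Fo) (u : List ℕ) (k : ℕ) (v : List ℕ) :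
    lc (blk (Fseq f) (k + 1, u)) (c1map v) = psiF (.mk f) (u ++ [k]) v - psiF (.mk f) [k] v := by
  rcases nil_or_snoc v with rfl | ⟨w, n, rfl⟩
  · rw [c1map_nil, lc_zero, psiF_dead (by simp [Fo.live]), psiF_dead (by simp [Fo.live]), sub_zero]
  · by_cases hw : w = []
    · subst hw
      rw [List.nil_append, c1map_single, lc_single, blk, ind_false (by simp), zero_mul, smul_zero, eq_comm,
        sub_eq_zero]
      apply ind_congr
      have h1 := suffix_append_single (w := []) (u := u) (k := n) (k' := k)
      have h2 := suffix_append_single (w := []) (u := []) (k := n) (k' := k)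
      simp only [List.nil_append] at h1 h2
      rw [h1, h2]
      simp
    · have h0 : psiF (.mk f) [k] (w ++ [n]) = 0 := by
        apply ind_false
        rintro ⟨-, h⟩
        have := (suffix_append_single (u := [])).1 h
        exact hw (List.suffix_nil.1 this.1)
      rw [c1map_append hw, lc_single, h0, sub_zero, one_smul]
      simp only [blk, psiF, Fseq, suffix_append_single, Fo.live_append_single, hw, false_or]
      by_cases hn : n = k
      · subst hn
        rw [ind_true rfl, one_mul]
        exact ind_congr (by simp)
      · rw [ind_false (by omega), zero_mul, ind_false (by tauto)]

/-- Step 3: all monotone forests. -/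
lemma good_forest [CompleteSpace X] [TopologicalSpace.SeparableSpace X] {K : ℝ}
    (hK : IsKElastic X K) (hK1 : 1 ≤ K) (hd : Good X delta K) (F : Fo) (hF : F.Mono) :
    Good X (psiF F) K := by
  induction F with
  | empty =>
    have h0 : ∀ u, psiF .empty u = fun _ => 0 := fun u => by
      funext v
      exact psiF_dead (Fo.not_live_empty v) u
    refine ⟨fun _ => 0, fun a j => ?_, fun a R hR _ => ?_⟩
    · rw [h0, lc_const_zero, abs_zero]
      positivity
    · rw [lc_const_zero, norm_zero]
      have : 0 ≤ K := by linarith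
      positivity
  | mk f ih =>
    have hblk : Good X (blk (Fseq f)) K := by
      apply good_blk hK hK1
      · intro n
        cases n with
        | zero => exact ⟨fun _ => trivial, fun _ _ _ => trivial⟩
        | succ n => exact hF.1 n
      · intro n
        cases n with
        | zero => exact good_F0 hK hK1 hd
        | succ n => exact ih n (hF.1 n)
    refine good_transfer hK hK1 _ _ hblk (fun i => ⟨1, fun j => abs_psiF_le _ _ _⟩) c1map 2 2
      (by norm_num) (by norm_num) ?_ ?_
    · intro a u M hM h
      rcases nil_or_snoc u with rfl | ⟨w, k, rfl⟩
      · have : lc (psiF (.mk f) []) a = lc (fun _ => (0 : ℝ)) a := by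
          apply lc_congr
          intro v _
          apply ind_false
          rintro ⟨h1, h2⟩
          exact Fo.live_ne h1 (List.suffix_nil.1 h2)
        rw [this, lc_const_zero, abs_zero]
        positivity
      · have h1 := h (0, [] ++ [k])
        have h2 := h (k + 1, w)
        simp only [blk_c1_zero] at h1
        simp only [blk_c1_succ, lc_fun_sub] at h2
        have h3 : lc (psiF (.mk f) (w ++ [k])) a = lc (fun v => psiF (.mk f) [k] v) a +
          (lc (fun v => psiF (.mk f) (w ++ [k]) v) a - lc (fun v => psiF (.mk f) [k] v) a) := by ring
        rw [h3]
        refine (abs_add_le _ _).trans ?_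
        linarith
    · rintro a R hR h ⟨n, u⟩
      cases n with
      | zero =>
        rcases nil_or_snoc u with rfl | ⟨w, k, rfl⟩
        · simp only [blk_c1_zero_nil, lc_const_zero, abs_zero]
          positivity
        · simp only [blk_c1_zero]
          have := h [k]
          change |lc (psiF (.mk f) [k]) a| ≤ _
          linarith
      | succ k =>
        simp only [blk_c1_succ, lc_fun_sub]
        have h1 := h [k]
        have h2 := h (u ++ [k])
        refine (abs_sub _ _).trans ?_
        change |lc (psiF (.mk f) (u ++ [k])) a| + |lc (psiF (.mk f) [k]) a| ≤ _
        linarith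

end

end ElU

namespace ElU

open Filter Topology Encodable

/-- Finite joins. -/
def joinUpTo (F : ℕ → Fo) : ℕ → Fo
  | 0 => F 0
  | k + 1 => Fo.join (joinUpTo F k) (F (k + 1))

lemma joinUpTo_mono (F : ℕ → Fo) (hF : ∀ i, (F i).Mono) (k : ℕ) : (joinUpTo F k).Mono := by
  induction k with
  | zero => exact hF 0
  | succ k ih => exact Fo.Mono_join ih (hF _)

lemma joinUpTo_le (F : ℕ → Fo) {i j : ℕ} (h : i ≤ j) : (joinUpTo F i).le (joinUpTo F j) := by
  induction h with
  | refl => exact Fo.le_refl' _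
  | step _ ih => exact Fo.le_trans' ih (Fo.le_join_left _ _)

lemma le_joinUpTo (F : ℕ → Fo) (k : ℕ) : (F k).le (joinUpTo F k) := by
  cases k with
  | zero => exact Fo.le_refl' _
  | succ k => exact Fo.le_join_right _ _

lemma exists_forest (S : List ℕ → Prop) (hS : ∀ u v, v <:+ u → S u → S v) (hW : WellFounded (ExtRel S)) :
    ∃ F : Fo, F.Mono ∧ ∀ u, u ≠ [] → S u → F.live u := by
  have key : ∀ r, ∃ F : Fo, F.Mono ∧ ∀ u, u ≠ [] → S (u ++ r) → F.live u := by
    intro r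
    induction r using hW.induction with
    | _ r ih =>
      have : ∀ i, ∃ F : Fo, F.Mono ∧ ∀ u, u ≠ [] → S (u ++ (i :: r)) → F.live u := by
        intro i
        by_cases hi : S (i :: r)
        · exact ih (i :: r) ⟨hi, i, rfl⟩
        · exact ⟨.empty, trivial, fun u _ hu => absurd (hS _ _ (List.suffix_append _ _) hu) hi⟩
      choose F hF1 hF2 using this
      refine ⟨.mk (joinUpTo F), ⟨joinUpTo_mono F hF1, fun i j h => joinUpTo_le F h⟩, fun u hu hSu => ?_⟩
      rcases nil_or_snoc u with rfl | ⟨w, k, rfl⟩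
      · exact absurd rfl hu
      · rw [Fo.live_append_single]
        by_cases hw : w = []
        · exact Or.inl hw
        · right
          apply Fo.live_le (le_joinUpTo F k)
          apply hF2 k w hw
          simpa using hSu
  obtain ⟨F, h1, h2⟩ := key []
  exact ⟨F, h1, fun u hu h => h2 u hu (by simpa using h)⟩

/-- Re-coding of lists along a branch. -/
def RR (τ : List ℕ) : List ℕ → List ℕ
  | [] => [encode (suf τ (encode ([] : List ℕ)))]
  | k :: p => encode (suf τ (encode (k :: p))) :: RR τ p

lemma RR_head (τ u : List ℕ) : ∃ q, RR τ u = encode (suf τ (encode u)) :: q := by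
  cases u with
  | nil => exact ⟨_, rfl⟩
  | cons k p => exact ⟨_, rfl⟩

lemma RR_ne (τ u : List ℕ) : RR τ u ≠ [] := by
  obtain ⟨q, hq⟩ := RR_head τ u
  simp [hq]

lemma RR_length (τ u : List ℕ) : (RR τ u).length = u.length + 1 := by
  induction u with
  | nil => rfl
  | cons k p ih => simp [RR, ih]

lemma RR_suf {τ u : List ℕ} {m : ℕ} (h1 : encode u ≤ m) (h2 : m ≤ τ.length) : RR (suf τ m) u = RR τ u := by
  induction u with
  | nil => simp only [RR, suf_suf h1 h2]
  | cons k p ih => simp only [RR, suf_suf h1 h2, ih ((encode_tail_lt k p).le.trans h1)]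

lemma RR_mono {τ u w : List ℕ} (h : w <:+ u) : RR τ w <:+ RR τ u := by
  induction u with
  | nil => rw [List.suffix_nil.1 h]
  | cons k p ih =>
    rcases List.suffix_cons_iff.1 h with rfl | h
    · exact List.suffix_refl _
    · exact (ih h).trans (List.suffix_cons _ _)

lemma RR_inj {τ u w : List ℕ} (hu : encode u ≤ τ.length) (hw : encode w ≤ τ.length)
    (h : RR τ w = RR τ u) : w = u := by
  obtain ⟨q, hq⟩ := RR_head τ u
  obtain ⟨q', hq'⟩ := RR_head τ w
  rw [hq, hq'] at h
  have h1 := Encodable.encode_injective (List.cons.inj h).1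
  have h2 := congrArg List.length h1
  rw [suf_length hu, suf_length hw] at h2
  exact Encodable.encode_injective h2

lemma RR_suffix {τ u w : List ℕ} (hu : encode u ≤ τ.length) (hw : encode w ≤ τ.length)
    (h : RR τ w <:+ RR τ u) : w <:+ u := by
  induction u with
  | nil =>
    rcases List.suffix_cons_iff.1 h with h' | h'
    · rw [RR_inj hu hw h']
    · exact absurd (List.suffix_nil.1 h') (RR_ne _ _)
  | cons k p ih =>
    rcases List.suffix_cons_iff.1 h with h' | h'
    · rw [RR_inj hu hw h']
    · exact (ih ((encode_tail_lt k p).le.trans hu) h').trans (List.suffix_cons _ _)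

lemma suf_suffix_suf (τ : List ℕ) {k m : ℕ} (h : k ≤ m) : suf τ k <:+ suf τ m := by
  have : suf τ k = (suf τ m).drop ((τ.length - k) - (τ.length - m)) := by
    simp only [suf, List.drop_drop]
    congr 1
    omega
  rw [this]
  exact List.drop_suffix _ _

lemma RR_step {τ u : List ℕ} (hu : encode u ≤ τ.length) {n h : ℕ} {v : List ℕ} (hs : n :: h :: v <:+ RR τ u) :
    ∃ σ' σ : List ℕ, n = encode σ' ∧ h = encode σ ∧ σ' <:+ τ ∧ σ <:+ σ' ∧ σ.length < σ'.length := by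
  induction u with
  | nil =>
    have := hs.length_le
    simp [RR] at this
  | cons k p ih =>
    have hp := (encode_tail_lt k p).le.trans hu
    rcases List.suffix_cons_iff.1 hs with h' | h'
    · obtain ⟨q, hq⟩ := RR_head τ p
      rw [hq] at h'
      obtain ⟨h1, h2⟩ := List.cons.inj h'
      obtain ⟨h2, h3⟩ := List.cons.inj h2
      refine ⟨_, _, h1, h2, suf_suffix _ _, suf_suffix_suf τ (encode_tail_lt k p).le, ?_⟩
      rw [suf_length hu, suf_length hp]
      exact encode_tail_lt k p
    · exact ih hp h'

lemma transGen_of_suffix {T : List ℕ → Prop} (hTs : ∀ n τ, T (n :: τ) → T τ) {σ σ' : List ℕ}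
    (h : σ <:+ σ') (hl : σ.length < σ'.length) (hT : T σ') : Relation.TransGen (ExtRel T) σ' σ := by
  induction σ' with
  | nil => simp at hl
  | cons n p ih =>
    have h1 : ExtRel T (n :: p) p := ⟨hT, n, rfl⟩
    rcases List.suffix_cons_iff.1 h with rfl | h
    · simp at hl
    · by_cases hp : σ.length < p.length
      · exact Relation.TransGen.head h1 (ih h hp (hTs _ _ hT))
      · rw [h.eq_of_length_le (by omega)]
        exact Relation.TransGen.single h1

lemma RR_wf {T : List ℕ → Prop} (hTs : ∀ n τ, T (n :: τ) → T τ)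
    (hTsuf : ∀ ρ τ : List ℕ, ρ <:+ τ → T τ → T ρ) (hW : WellFounded (ExtRel T)) :
    WellFounded (ExtRel fun v => ∃ τ u, T τ ∧ encode u ≤ τ.length ∧ v <:+ RR τ u) := by
  have hW' : WellFounded (Relation.TransGen (ExtRel T)) := hW.transGen
  have key : ∀ σ : List ℕ, ∀ v, Acc (ExtRel fun v => ∃ τ u, T τ ∧ encode u ≤ τ.length ∧ v <:+ RR τ u)
      (encode σ :: v) := by
    intro σ
    induction σ using hW'.induction with
    | _ σ ih =>
      intro v
      constructor
      rintro v' ⟨⟨τ, u, hτ, hu, hs⟩, n, rfl⟩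
      obtain ⟨σ', σ2, rfl, h2, h3, h4, h5⟩ := RR_step hu hs
      have h2 := Encodable.encode_injective h2
      subst h2
      exact ih σ' (transGen_of_suffix hTs h4 h5 (hTsuf _ _ h3 hτ)) _
  have key2 : ∀ n v, Acc (ExtRel fun v => ∃ τ u, T τ ∧ encode u ≤ τ.length ∧ v <:+ RR τ u) (n :: v) := by
    intro n v
    have := key (Denumerable.ofNat (List ℕ) n) v
    rwa [Denumerable.encode_ofNat] at this
  constructor
  intro v
  constructor
  rintro v' ⟨-, n, rfl⟩
  exact key2 n v

lemma exists_longest (P : List ℕ → Prop) (N : ℕ) (hN : ∀ w, P w → w.length ≤ N) (hex : ∃ w, P w) :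
    ∃ w, P w ∧ ∀ v, P v → v.length ≤ w.length := by
  classical
  let Q : ℕ → Prop := fun n => ∃ w, P w ∧ w.length = n
  have hQ : Q (Nat.findGreatest Q N) := by
    obtain ⟨w, h⟩ := hex
    exact Nat.findGreatest_spec (m := w.length) (hN w h) ⟨w, h, rfl⟩
  obtain ⟨w, h1, h2⟩ := hQ
  refine ⟨w, h1, fun v hv => ?_⟩
  rw [h2]
  exact Nat.le_findGreatest (hN v hv) ⟨v, hv, rfl⟩

/-- The full tree family. -/
noncomputable def full : List ℕ → List ℕ → ℝ := fun u v => ind (v <:+ u)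

lemma full_coord (k : ℕ) (p v : List ℕ) : full (k :: p) v - full p v = ind (v = k :: p) := by
  simp only [full]
  by_cases hv : v = k :: p
  · subst hv
    rw [ind_true (List.suffix_refl _), ind_true rfl, ind_false, sub_zero]
    intro h
    have := h.length_le
    simp at this
  · rw [ind_false hv, sub_eq_zero]
    apply ind_congr
    rw [List.suffix_cons_iff]
    tauto

section
variable {X : Type} [NormedAddCommGroup X] [NormedSpace ℝ X]

/-- Step 4. -/
lemma good_full [CompleteSpace X] [TopologicalSpace.SeparableSpace X] {K : ℝ}
    (hK : IsKElastic X K) (hK1 : 1 ≤ K) (hd : Good X delta K) : Good X full K := by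
  apply good_equiv (Denumerable.eqv (List ℕ)).symm
  set e : ℕ ≃ List ℕ := (Denumerable.eqv (List ℕ)).symm with he
  have hee : ∀ m, encode (e m) = m := fun m => Denumerable.encode_ofNat m
  have hee' : ∀ u, e (encode u) = u := fun u => Denumerable.ofNat_encode u
  obtain ⟨x, hxL, hxU⟩ := principle (X := X) K (fun u m => full u (e m)) (fun _ => True) (by
    intro m _
    refine ⟨2, fun a R hR h => ?_⟩
    rcases hm : e m with _ | ⟨k, p⟩
    · have h1 := h []
      have : lc (fun i => full [] (e i)) a = a m := by
        rw [← lc_ind_eq a m]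
        apply lc_congr
        intro i _
        apply ind_congr
        rw [List.suffix_nil, ← hm]
        exact e.injective.eq_iff
      simp only [this] at h1
      linarith
    · have h1 := h (k :: p)
      have h2 := h p
      have : a m = lc (fun i => full (k :: p) (e i)) a - lc (fun i => full p (e i)) a := by
        rw [← lc_fun_sub, ← lc_ind_eq a m]
        apply lc_congr
        intro i _
        rw [full_coord]
        apply ind_congr
        rw [← hm]
        exact e.injective.eq_iff.symm
      rw [this]
      refine (abs_sub _ _).trans ?_
      linarith) (by
    intro T hT0 hTs hW
    have hTsuf : ∀ ρ τ : List ℕ, ρ <:+ τ → T τ → T ρ := by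
      intro ρ τ h
      induction τ with
      | nil => intro hτ; rwa [List.suffix_nil.1 h]
      | cons n τ ih =>
        intro hτ
        rcases List.suffix_cons_iff.1 h with h | h
        · rwa [h]
        · exact ih h (hTs _ _ hτ)
    obtain ⟨F, hF, hlive⟩ := exists_forest _ (by
      rintro u v h ⟨τ, w, h1, h2, h3⟩
      exact ⟨τ, w, h1, h2, h.trans h3⟩) (RR_wf hTs hTsuf hW)
    obtain ⟨x, hxL, hxU⟩ := good_forest hK hK1 hd F hF
    refine ⟨fun τ => x (RR τ (e τ.length)), fun τ h => absurd trivial h, fun τ hτ a ha => ?_⟩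
    have hle : ∀ m, a m ≠ 0 → m ≤ τ.length := fun m hm => by
      by_contra h
      exact hm (ha m (by omega))
    have e1 : lc (fun m => x (RR (suf τ m) (e (suf τ m).length))) a =
        lc x (a.mapDomain fun m => RR τ (e m)) := by
      rw [lc_mapDomain]
      apply lc_congr
      intro m hm
      rw [suf_length (hle m hm), RR_suf (hee m).le (hle m hm)]
    have hlv : ∀ m, m ≤ τ.length → F.live (RR τ (e m)) := by
      intro m hm
      exact hlive _ (RR_ne _ _) ⟨τ, e m, hτ, by rwa [hee], List.suffix_refl _⟩
    simp only at e1 ⊢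
    rw [e1]
    constructor
    · intro u
      obtain ⟨w, ⟨hw1, hw2⟩, hw3⟩ := exists_longest (fun w => w <:+ u ∧ encode w ≤ τ.length) u.length
        (fun w h => h.1.length_le) ⟨[], List.nil_suffix, by simp⟩
      have := hxL (a.mapDomain fun m => RR τ (e m)) (RR τ w)
      rw [one_mul] at this
      convert this using 2
      rw [lc_mapDomain]
      apply lc_congr
      intro m hm
      have hm := hle m hm
      apply ind_congr
      constructor
      · intro h
        refine ⟨hlv m hm, RR_mono ?_⟩
        exact List.suffix_of_suffix_length_le h hw1 (hw3 _ ⟨h, by rwa [hee]⟩)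
      · rintro ⟨-, h⟩
        exact (RR_suffix hw2 (by rwa [hee]) h).trans hw1
    · intro R hR hj
      apply hxU _ R hR
      intro u
      rw [lc_mapDomain]
      by_cases hex : ∃ w, RR τ w <:+ u ∧ encode w ≤ τ.length
      · obtain ⟨w, ⟨hw1, hw2⟩, hw3⟩ := exists_longest (fun w => RR τ w <:+ u ∧ encode w ≤ τ.length) u.length
          (fun w h => by
            have := h.1.length_le
            rw [RR_length] at this
            omega) hex
        convert hj w using 2
        apply lc_congr
        intro m hm
        have hm := hle m hm
        apply ind_congr
        constructor
        · rintro ⟨-, h⟩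
          have h1 := hw3 _ ⟨h, by rwa [hee]⟩
          apply RR_suffix hw2 (by rwa [hee])
          exact List.suffix_of_suffix_length_le h hw1 (by rw [RR_length, RR_length]; omega)
        · intro h
          exact ⟨hlv m hm, (RR_mono h).trans hw1⟩
      · have : lc (fun m => psiF F u (RR τ (e m))) a = lc (fun _ => (0 : ℝ)) a := by
          apply lc_congr
          intro m hm
          apply ind_false
          rintro ⟨-, h⟩
          exact hex ⟨e m, h, by rw [hee]; exact hle m hm⟩
        rw [this, lc_const_zero, abs_zero]
        exact hR)
  exact elastic_good hK hK1 _ (fun i => ⟨1, fun j => abs_ind_le _⟩) x 2 (K + 1) hxL hxU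

end

end ElU

namespace ElU

open Filter Topology

/-- Total size of a list. -/
def en : List ℕ → ℕ
  | [] => 0
  | k :: p => en p + k + 1

/-- Point of the Cantor space attached to a list. -/
def om : List ℕ → ℕ → Bool
  | [], _ => false
  | k :: p, i => om p i || decide (en p + k = i)

lemma om_lt {u : List ℕ} {i : ℕ} (h : om u i = true) : i + 1 ≤ en u := by
  induction u with
  | nil => simp [om] at h
  | cons k p ih =>
    simp only [om, Bool.or_eq_true, decide_eq_true_eq] at h
    simp only [en]
    rcases h with h | h
    · have := ih h
      omega
    · omega

lemma om_dense (w : ℕ → Bool) (n : ℕ) : ∃ u, en u ≤ n ∧ ∀ i < n, om u i = w i := by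
  induction n with
  | zero => exact ⟨[], by simp [en], fun i hi => absurd hi (by omega)⟩
  | succ n ih =>
    obtain ⟨u, hu, h⟩ := ih
    have hn : om u n = false := by
      by_contra hc
      have := om_lt (Bool.eq_true_of_not_eq_false hc)
      omega
    by_cases hw : w n = true
    · refine ⟨(n - en u) :: u, by simp only [en]; omega, fun i hi => ?_⟩
      by_cases hin : i = n
      · subst hin
        simp only [om, hw, Bool.or_eq_true, decide_eq_true_eq]
        right
        omega
      · have : ¬ (en u + (n - en u) = i) := by omega
        simp only [om, this, decide_false, Bool.or_false]
        exact h i (by omega)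
    · refine ⟨u, by omega, fun i hi => ?_⟩
      by_cases hin : i = n
      · subst hin
        rw [hn]
        exact (Bool.eq_false_of_not_eq_true hw).symm
      · exact h i (by omega)

lemma unif_cantor (f : (ℕ → Bool) → ℝ) (hf : Continuous f) {ε : ℝ} (hε : 0 < ε) :
    ∃ n : ℕ, ∀ w w' : ℕ → Bool, (∀ i < n, w i = w' i) → |f w - f w'| < ε := by
  by_contra! h
  choose w w' h1 h2 using h
  obtain ⟨a, φ, hφ, ha⟩ := CompactSpace.tendsto_subseq w
  have ha' : Tendsto (w' ∘ φ) atTop (𝓝 a) := by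
    rw [tendsto_pi_nhds] at ha ⊢
    intro i
    refine (ha i).congr' ?_
    filter_upwards [eventually_gt_atTop i] with n hn
    exact h1 (φ n) i (lt_of_lt_of_le hn (hφ.id_le n))
  have h3 := ((hf.tendsto a).comp ha).sub ((hf.tendsto a).comp ha')
  rw [sub_self] at h3
  have h4 := h3.abs
  rw [abs_zero] at h4
  obtain ⟨n, hn⟩ := (h4.eventually (gt_mem_nhds hε)).exists
  exact absurd hn (not_lt.2 (h2 (φ n)))

lemma en_finite (n : ℕ) : {v : List ℕ | en v ≤ n}.Finite := by
  induction n with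
  | zero =>
    refine (Set.finite_singleton ([] : List ℕ)).subset fun v hv => ?_
    cases v with
    | nil => rfl
    | cons k p => simp [en] at hv
  | succ n ih =>
    have hfin : (Set.image2 (fun k p => k :: p) (Set.Iic n) {v : List ℕ | en v ≤ n}).Finite :=
      (Set.finite_Iic n).image2 _ ih
    refine (hfin.union (Set.finite_singleton ([] : List ℕ))).subset fun v hv => ?_
    cases v with
    | nil => right; rfl
    | cons k p =>
      left
      simp only [Set.mem_ofPred_eq, en] at hv
      exact ⟨k, by simp only [Set.mem_Iic]; omega, p, by simp only [Set.mem_ofPred_eq]; omega, rfl⟩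

/-- Cut a list down to size at most `n`. -/
def trunc (n : ℕ) : List ℕ → List ℕ
  | [] => []
  | k :: p => if en p + k + 1 ≤ n then k :: p else trunc n p

lemma trunc_of_le {n : ℕ} {u : List ℕ} (h : en u ≤ n) : trunc n u = u := by
  cases u with
  | nil => rfl
  | cons k p =>
    simp only [en] at h
    simp [trunc, h]

lemma om_trunc {n i : ℕ} (hi : i < n) (u : List ℕ) : om (trunc n u) i = om u i := by
  induction u with
  | nil => rfl
  | cons k p ih =>
    simp only [trunc]
    split_ifs with h
    · rfl
    · have : ¬ (en p + k = i) := by omega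
      simp [om, this, ih]

/-- Successive differences along the tree. -/
noncomputable def dif (f : (ℕ → Bool) → ℝ) : List ℕ → ℝ
  | [] => f (om [])
  | k :: p => f (om (k :: p)) - f (om p)

open Classical in
lemma approx (f : (ℕ → Bool) → ℝ) (hf : Continuous f) {ε : ℝ} (hε : 0 < ε) :
    ∃ a : List ℕ →₀ ℝ, ∀ u, |f (om u) - lc (full u) a| ≤ ε := by
  obtain ⟨n, hn⟩ := unif_cantor f hf hε
  let a : List ℕ →₀ ℝ := Finsupp.ofSupportFinite (fun v => if en v ≤ n then dif f v else 0)
    ((en_finite n).subset fun v hv => by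
      by_contra hc
      simp only [Set.mem_ofPred_eq] at hc
      simp [hc] at hv)
  have ha : ∀ v, a v = if en v ≤ n then dif f v else 0 := fun v => rfl
  have key : ∀ u, lc (full u) a = f (om (trunc n u)) := by
    intro u
    induction u with
    | nil =>
      have : lc (full []) a = a [] := by
        rw [← lc_ind_eq a []]
        apply lc_congr
        intro i _
        apply ind_congr
        exact List.suffix_nil
      rw [this, ha]
      simp [en, dif, trunc]
    | cons k p ih =>
      have : lc (full (k :: p)) a = lc (full p) a + a (k :: p) := by
        rw [← sub_eq_iff_eq_add', ← lc_fun_sub, ← lc_ind_eq a (k :: p)]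
        apply lc_congr
        intro i _
        exact full_coord k p i
      rw [this, ha, ih]
      by_cases h : en (k :: p) ≤ n
      · have hp : en p ≤ n := by
          simp only [en] at h
          omega
        rw [if_pos h, trunc_of_le h, trunc_of_le hp, dif]
        ring
      · rw [if_neg h, add_zero]
        simp only [en] at h
        simp [trunc, h]
  refine ⟨a, fun u => ?_⟩
  rw [key]
  exact (hn _ _ fun i hi => (om_trunc hi u).symm).le

lemma exists_fun (Y : Type) [NormedAddCommGroup Y] [NormedSpace ℝ Y]
    [TopologicalSpace.SeparableSpace Y] :
    ∃ π : (ℕ → Bool) → (Y →L[ℝ] ℝ), (∀ y, Continuous fun w => π w y) ∧ (∀ w, ‖π w‖ ≤ 1) ∧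
      ∀ g : Y →L[ℝ] ℝ, ‖g‖ ≤ 1 → ∃ w, π w = g := by
  set B : Set (WeakDual ℝ Y) := WeakDual.toStrongDual ⁻¹' Metric.closedBall (0 : StrongDual ℝ Y) 1
    with hB
  have hc : IsCompact B := WeakDual.isCompact_closedBall 0 1
  haveI : CompactSpace B := isCompact_iff_compactSpace.mp hc
  haveI : TopologicalSpace.MetrizableSpace B := WeakDual.metrizable_of_isCompact ℝ Y B hc
  letI : MetricSpace B := TopologicalSpace.metrizableSpaceMetric B
  haveI : Nonempty B := ⟨⟨0, by simp [hB]⟩⟩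
  obtain ⟨π, h1, h2⟩ := exists_nat_bool_continuous_surjective_of_compact B
  refine ⟨fun w => WeakDual.toStrongDual (π w : WeakDual ℝ Y), fun y => ?_, fun w => ?_, fun g hg => ?_⟩
  · exact (WeakDual.eval_continuous y).comp (continuous_subtype_val.comp h1)
  · exact mem_closedBall_zero_iff.1 (π w).2
  · obtain ⟨w, hw⟩ := h2 ⟨StrongDual.toWeakDual g, by
      rw [hB, Set.mem_preimage, mem_closedBall_zero_iff]
      exact hg⟩
    refine ⟨w, ?_⟩
    simp only [hw]
    rfl

/-- Step 5. -/
lemma embeds_of_full {X : Type} [NormedAddCommGroup X] [NormedSpace ℝ X] [CompleteSpace X]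
    {K : ℝ} (hG : Good X full K)
    (Y : Type) [NormedAddCommGroup Y] [NormedSpace ℝ Y] [TopologicalSpace.SeparableSpace Y] :
    EmbedsInto Y X := by
  obtain ⟨x, hL, hU⟩ := hG
  obtain ⟨b, -, hb2, hb3, hb4⟩ := exists_lp full (fun i => ⟨1, fun j => abs_ind_le _⟩)
  obtain ⟨T, ⟨c, hc, hT⟩, -⟩ := span_ext b x 1 K
    (fun a => hb3 a _ (by positivity) (fun j => hL a j))
    (fun a => hU a _ (norm_nonneg _) (hb4 a))
  obtain ⟨π, h1, h2, h3⟩ := exists_fun Y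
  have hbd : ∀ y u, ‖π (om u) y‖ ≤ ‖y‖ := fun y u =>
    ((π (om u)).le_opNorm y).trans (by nlinarith [h2 (om u), norm_nonneg y])
  let j0 : Y →ₗ[ℝ] lp (fun _ : List ℕ => ℝ) ⊤ :=
    { toFun := fun y => ⟨fun u => π (om u) y, memℓp_infty ⟨‖y‖, by
        rintro _ ⟨u, rfl⟩
        exact hbd y u⟩⟩
      map_add' := fun y z => by
        ext u
        exact map_add (π (om u)) y z
      map_smul' := fun r y => by
        ext u
        exact map_smul (π (om u)) r y }
  have hj : ∀ y u, j0 y u = π (om u) y := fun y u => rfl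
  let j : Y →L[ℝ] lp (fun _ : List ℕ => ℝ) ⊤ := j0.mkContinuous 1 fun y => by
    rw [one_mul]
    exact lp.norm_le_of_forall_le (norm_nonneg y) (hbd y)
  have hj' : ∀ y u, j y u = π (om u) y := fun y u => rfl
  have hlow : ∀ y, ‖y‖ ≤ ‖j y‖ := by
    intro y
    obtain ⟨g, hg1, hg2⟩ := exists_dual_vector'' ℝ y
    obtain ⟨w, rfl⟩ := h3 g hg1
    apply le_of_forall_pos_le_add
    intro ε hε
    obtain ⟨n, hn⟩ := unif_cantor _ (h1 y) hε
    obtain ⟨u, -, hu⟩ := om_dense w n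
    have h5 := hn w (om u) fun i hi => (hu i hi).symm
    have h6 := lp.norm_apply_le_norm ENNReal.top_ne_zero (j y) u
    rw [hj', Real.norm_eq_abs] at h6
    simp only [RCLike.ofReal_real_eq_id, id_eq] at hg2
    rw [hg2] at h5
    have h7 := (abs_lt.1 h5).2
    have h8 := le_abs_self (π (om u) y)
    linarith
  have hmem : ∀ y, j y ∈ (Submodule.span ℝ (Set.range b)).topologicalClosure := by
    intro y
    rw [← SetLike.mem_coe, Submodule.topologicalClosure_coe, Metric.mem_closure_iff]
    intro ε hε
    obtain ⟨a, ha⟩ := approx _ (h1 y) (half_pos hε)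
    refine ⟨lc b a, ?_, ?_⟩
    · rw [SetLike.mem_coe, ← Finsupp.range_linearCombination]
      exact ⟨a, rfl⟩
    · rw [dist_eq_norm]
      refine lt_of_le_of_lt (lp.norm_le_of_forall_le (half_pos hε).le fun u => ?_) (half_lt_self hε)
      have := ha u
      rw [← hb2 a u] at this
      exact this
  refine ⟨T.comp (j.codRestrict _ hmem), c, hc, fun y => ?_⟩
  refine le_trans ?_ (hT _)
  exact mul_le_mul_of_nonneg_left (hlow y) hc.le

end ElU

/-- A separable infinite dimensional elastic Banach space is universal for
separable Banach spaces. -/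
theorem elastic_is_universal
    (X : Type) [NormedAddCommGroup X] [NormedSpace ℝ X] [CompleteSpace X]
    [TopologicalSpace.SeparableSpace X]
    (hinf : ¬ FiniteDimensional ℝ X)
    (K : ℝ) (hK : IsKElastic X K) :
    ∀ (Y : Type) [NormedAddCommGroup Y] [NormedSpace ℝ Y] [CompleteSpace Y]
      [TopologicalSpace.SeparableSpace Y], EmbedsInto Y X := by
  have hK1 : (1 : ℝ) ≤ max K 1 := le_max_right _ _
  have hK' : IsKElastic X (max K 1) := by
    intro Z _ _ _ hZ
    obtain ⟨T, hT⟩ := hK Z hZ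
    refine ⟨T, fun z => ⟨(hT z).1, (hT z).2.trans ?_⟩⟩
    exact mul_le_mul_of_nonneg_right (le_max_left _ _) (norm_nonneg z)
  have hG := ElU.good_full hK' hK1 (ElU.good_delta hK' hK1 hinf)
  intro Y _ _ _ _
  exact ElU.embeds_of_full hG Y
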